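/- Let φ : ℂ² → ℂ² be a smooth symplectomorphism. Then the surface φ(Σ), where Σ is the standard open Whitney umbrella, is locally polynomially convex at the point φ(0); that is, for every ε > 0 there exists a compact polynomially convex set K with φ(0) ∈ K ⊆ φ(Σ) ∩ B̄(φ(0), ε) such that K is a neighborhood of φ(0) in the relative topology of φ(Σ). -/

import Mathlib

open Metric

noncomputable section

/-- The standard open Whitney umbrella parametrization `π(t,s) = (ts, 2t³/3, t², s)`
in real coordinates `(x,u,y,v)`, viewed in `ℂ² = ℂ × ℂ` with `z = x + iy`, `w = u + iv`. -/
def whitneyPi (p : ℝ × ℝ) : ℂ × ℂ :=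
  (⟨p.1 * p.2, p.1 ^ 2⟩, ⟨2 * p.1 ^ 3 / 3, p.2⟩)

/-- The standard symplectic form `ω_st = dx∧dy + du∧dv` on `ℝ⁴ ≅ ℂ²`. -/
def omegaSt (p q : ℂ × ℂ) : ℝ :=
  p.1.re * q.1.im - p.1.im * q.1.re + p.2.re * q.2.im - p.2.im * q.2.re

/-- The polynomial hull of a set `K ⊆ ℂ²`. -/
def polyHull2 (K : Set (ℂ × ℂ)) : Set (ℂ × ℂ) :=
  {z | ∀ P : MvPolynomial (Fin 2) ℂ,
    ‖MvPolynomial.eval ![z.1, z.2] P‖ ≤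
      sSup ((fun w => ‖MvPolynomial.eval ![w.1, w.2] P‖) '' K)}

/-- A set `K ⊆ ℂ²` is polynomially convex if it equals its polynomial hull. -/
def IsPolynomiallyConvex (K : Set (ℂ × ℂ)) : Prop := polyHull2 K = K

/-- Evaluation of a polynomial in two variables at a point of `ℂ × ℂ`. -/
def pev (P : MvPolynomial (Fin 2) ℂ) (x : ℂ × ℂ) : ℂ := MvPolynomial.eval ![x.1, x.2] P

/-- `q` lies in the polynomial hull of `K`, phrased through arbitrary upper bounds. -/
def InHull (K : Set (ℂ × ℂ)) (q : ℂ × ℂ) : Prop :=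
  ∀ (P : MvPolynomial (Fin 2) ℂ) (M : ℝ), (∀ x ∈ K, ‖pev P x‖ ≤ M) → ‖pev P q‖ ≤ M

lemma continuous_pev (P : MvPolynomial (Fin 2) ℂ) : Continuous (pev P) := by
  unfold pev
  have : Continuous fun x : ℂ × ℂ => (![x.1, x.2] : Fin 2 → ℂ) := by
    refine continuous_pi fun i => ?_
    fin_cases i
    · exact continuous_fst
    · exact continuous_snd
  exact (MvPolynomial.continuous_eval P).comp this

lemma inHull_of_mem_polyHull2 {K : Set (ℂ × ℂ)} (hne : K.Nonempty) {q : ℂ × ℂ}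
    (hq : q ∈ polyHull2 K) : InHull K q := by
  intro P M h
  refine (hq P).trans (csSup_le (hne.image _) ?_)
  rintro _ ⟨x, hx, rfl⟩
  exact h x hx

lemma subset_polyHull2 {K : Set (ℂ × ℂ)} (hK : IsCompact K) : K ⊆ polyHull2 K := by
  intro q hq P
  refine le_csSup ?_ ⟨q, hq, rfl⟩
  exact (hK.image (continuous_pev P).norm).bddAbove

lemma InHull.nonempty {K : Set (ℂ × ℂ)} {q : ℂ × ℂ} (h : InHull K q) : K.Nonempty := by
  by_contra hne
  rw [Set.not_nonempty_iff_eq_empty] at hne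
  subst hne
  have := h 1 (-1) (by simp)
  linarith [norm_nonneg (pev 1 q)]

lemma pev_bind (P P1 P2 : MvPolynomial (Fin 2) ℂ) (x : ℂ × ℂ) :
    pev (MvPolynomial.bind₁ ![P1, P2] P) x = pev P (pev P1 x, pev P2 x) := by
  unfold pev
  rw [← MvPolynomial.coe_aeval_eq_eval, ← MvPolynomial.coe_aeval_eq_eval]
  simp only [RingHom.coe_coe]
  rw [MvPolynomial.aeval_bind₁]
  congr 1
  congr 1
  funext i
  fin_cases i <;> simp

lemma InHull.map {K : Set (ℂ × ℂ)} {q : ℂ × ℂ} (h : InHull K q)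
    (P1 P2 : MvPolynomial (Fin 2) ℂ) :
    InHull ((fun x => (pev P1 x, pev P2 x)) '' K) (pev P1 q, pev P2 q) := by
  intro P M hM
  rw [← pev_bind]
  refine h _ M fun x hx => ?_
  rw [pev_bind]
  exact hM _ ⟨x, hx, rfl⟩

@[simp] lemma pev_X0 (x : ℂ × ℂ) : pev (MvPolynomial.X 0) x = x.1 := by simp [pev]
@[simp] lemma pev_X1 (x : ℂ × ℂ) : pev (MvPolynomial.X 1) x = x.2 := by simp [pev]
@[simp] lemma pev_C (c : ℂ) (x : ℂ × ℂ) : pev (MvPolynomial.C c) x = c := by simp [pev]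
@[simp] lemma pev_zero (x : ℂ × ℂ) : pev 0 x = 0 := by simp [pev]
@[simp] lemma pev_add (P Q) (x : ℂ × ℂ) : pev (P + Q) x = pev P x + pev Q x := by simp [pev]
@[simp] lemma pev_sub (P Q) (x : ℂ × ℂ) : pev (P - Q) x = pev P x - pev Q x := by simp [pev]
@[simp] lemma pev_neg (P) (x : ℂ × ℂ) : pev (-P) x = -pev P x := by simp [pev]
@[simp] lemma pev_mul (P Q) (x : ℂ × ℂ) : pev (P * Q) x = pev P x * pev Q x := by simp [pev]
@[simp] lemma pev_pow (P) (n : ℕ) (x : ℂ × ℂ) : pev (P ^ n) x = pev P x ^ n := by simp [pev]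

lemma exists_even_odd (P : MvPolynomial (Fin 2) ℂ) : ∃ P0 P1 : MvPolynomial (Fin 2) ℂ,
    ∀ a b : ℂ, pev P (a, b) = pev P0 (a ^ 2, b) + a * pev P1 (a ^ 2, b) := by
  induction P using MvPolynomial.induction_on with
  | C c => exact ⟨MvPolynomial.C c, MvPolynomial.C 0, by simp⟩
  | add P Q hP hQ =>
    obtain ⟨P0, P1, h⟩ := hP
    obtain ⟨Q0, Q1, k⟩ := hQ
    refine ⟨P0 + Q0, P1 + Q1, fun a b => ?_⟩
    simp [h, k]
    ring
  | mul_X P i h =>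
    obtain ⟨P0, P1, h⟩ := h
    fin_cases i
    · refine ⟨MvPolynomial.X 0 * P1, P0, fun a b => ?_⟩
      simp [h]
      ring
    · refine ⟨P0 * MvPolynomial.X 1, P1 * MvPolynomial.X 1, fun a b => ?_⟩
      simp [h]
      ring

lemma le_of_pow_le_two_mul_pow {x M : ℝ} (hM : 0 ≤ M)
    (h : ∀ n : ℕ, x ^ n ≤ 2 * M ^ n) : x ≤ M := by
  by_contra! hlt
  rcases hM.eq_or_lt with rfl | hM
  · have := h 1
    simp at this
    linarith
  · have h1 : 1 < x / M := by rwa [one_lt_div hM]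
    obtain ⟨n, hn⟩ := pow_unbounded_of_one_lt 2 h1
    rw [div_pow, lt_div_iff₀ (by positivity)] at hn
    linarith [h n]

/-- Points of the hull lift through the branched double cover `(a, b) ↦ (a ^ 2, b)`. -/
lemma InHull.sqrt_lift {K : Set (ℂ × ℂ)} {a b : ℂ} (h : InHull K (a ^ 2, b)) :
    InHull {x | (x.1 ^ 2, x.2) ∈ K} (a, b) := by
  intro P M hM
  have hsq : ∀ y ∈ K, ∃ z : ℂ, z ^ 2 = y.1 := fun y _ =>
    IsAlgClosed.exists_pow_nat_eq y.1 (by norm_num)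
  have hM0 : 0 ≤ M := by
    obtain ⟨y, hy⟩ := h.nonempty
    obtain ⟨z, hz⟩ := hsq y hy
    refine (norm_nonneg _).trans (hM (z, y.2) ?_)
    simpa [hz] using hy
  refine le_of_pow_le_two_mul_pow hM0 fun n => ?_
  obtain ⟨P0, P1, hP⟩ := exists_even_odd (P ^ n)
  have key : ∀ y ∈ K, ∀ z : ℂ, z ^ 2 = y.1 →
      ‖pev P0 y + z * pev P1 y‖ ≤ M ^ n ∧ ‖pev P0 y - z * pev P1 y‖ ≤ M ^ n := by
    intro y hy z hz
    have e1 := hP z y.2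
    have e2 := hP (-z) y.2
    have m1 : (z, y.2) ∈ {x : ℂ × ℂ | (x.1 ^ 2, x.2) ∈ K} := by simpa [hz] using hy
    have m2 : (-z, y.2) ∈ {x : ℂ × ℂ | (x.1 ^ 2, x.2) ∈ K} := by simpa [hz] using hy
    rw [neg_sq] at e2
    rw [hz, pev_pow] at e1 e2
    constructor
    · rw [← e1, norm_pow]
      exact pow_le_pow_left₀ (norm_nonneg _) (hM _ m1) n
    · rw [sub_eq_add_neg, ← neg_mul, ← e2, norm_pow]
      exact pow_le_pow_left₀ (norm_nonneg _) (hM _ m2) n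
  have b0 : ‖pev P0 (a ^ 2, b)‖ ≤ M ^ n := by
    refine h P0 _ fun y hy => ?_
    obtain ⟨z, hz⟩ := hsq y hy
    obtain ⟨k1, k2⟩ := key y hy z hz
    have : (2 : ℂ) * pev P0 y = (pev P0 y + z * pev P1 y) + (pev P0 y - z * pev P1 y) := by ring
    have h2 := norm_add_le (pev P0 y + z * pev P1 y) (pev P0 y - z * pev P1 y)
    rw [← this, norm_mul] at h2
    norm_num at h2
    linarith
  have b1 : ‖pev (MvPolynomial.X 0 * P1 ^ 2) (a ^ 2, b)‖ ≤ (M ^ n) ^ 2 := by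
    refine h _ _ fun y hy => ?_
    obtain ⟨z, hz⟩ := hsq y hy
    obtain ⟨k1, k2⟩ := key y hy z hz
    have : (2 : ℂ) * (z * pev P1 y) =
      (pev P0 y + z * pev P1 y) - (pev P0 y - z * pev P1 y) := by ring
    have h2 := norm_sub_le (pev P0 y + z * pev P1 y) (pev P0 y - z * pev P1 y)
    rw [← this, norm_mul] at h2
    norm_num at h2
    have h3 : ‖z * pev P1 y‖ ≤ M ^ n := by rw [norm_mul]; linarith
    have h4 : pev (MvPolynomial.X 0 * P1 ^ 2) y = (z * pev P1 y) ^ 2 := by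
      simp [← hz]
      ring
    rw [h4, norm_pow]
    exact pow_le_pow_left₀ (norm_nonneg _) h3 2
  have b1' : ‖a * pev P1 (a ^ 2, b)‖ ≤ M ^ n := by
    have h4 : pev (MvPolynomial.X 0 * P1 ^ 2) (a ^ 2, b) = (a * pev P1 (a ^ 2, b)) ^ 2 := by
      simp
      ring
    rw [h4, norm_pow] at b1
    exact le_of_sq_le_sq b1 (by positivity)
  rw [← norm_pow, ← pev_pow, hP]
  refine (norm_add_le _ _).trans ?_
  linarith

/-- The uniform closure on `Ω` of the polynomials. -/
def polyAlg (Ω : Set (ℂ × ℂ)) [CompactSpace Ω] : Subalgebra ℂ C(Ω, ℂ) :=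
  (MvPolynomial.aeval (R := ℂ) (![⟨fun x : Ω => x.1.1, by fun_prop⟩,
    ⟨fun x : Ω => x.1.2, by fun_prop⟩] : Fin 2 → C(Ω, ℂ))).range.topologicalClosure

lemma aeval_coord_apply {Ω : Set (ℂ × ℂ)} (P : MvPolynomial (Fin 2) ℂ) (x : Ω) :
    (MvPolynomial.aeval (R := ℂ) (![⟨fun x : Ω => x.1.1, by fun_prop⟩,
    ⟨fun x : Ω => x.1.2, by fun_prop⟩] : Fin 2 → C(Ω, ℂ)) P) x = pev P x := by
  induction P using MvPolynomial.induction_on with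
  | C c => simp
  | add P Q hP hQ => simp [hP, hQ]
  | mul_X P i h =>
    rw [map_mul, ContinuousMap.mul_apply, h]
    fin_cases i <;> simp

section

variable {Ω : Set (ℂ × ℂ)} [CompactSpace Ω]

instance : CompleteSpace (polyAlg Ω) :=
  (Subalgebra.isClosed_topologicalClosure _).completeSpace_coe

/-- A polynomial as an element of `polyAlg Ω`. -/
def polyElt (Ω : Set (ℂ × ℂ)) [CompactSpace Ω] (P : MvPolynomial (Fin 2) ℂ) : polyAlg Ω :=
  ⟨_, Subalgebra.le_topologicalClosure _ ⟨P, rfl⟩⟩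

/-- Evaluation of an element of `polyAlg Ω`. -/
def evalAlg (x : Ω) : polyAlg Ω →ₐ[ℂ] ℂ :=
  (ContinuousMap.evalAlgHom ℂ ℂ x).comp (polyAlg Ω).val

@[simp] lemma evalAlg_polyElt (x : Ω) (P) : evalAlg x (polyElt Ω P) = pev P x :=
  aeval_coord_apply P x

lemma continuous_evalAlg (x : Ω) : Continuous (evalAlg x) :=
  (continuous_eval_const x).comp continuous_subtype_val

lemma norm_evalAlg_le (x : Ω) (g : polyAlg Ω) : ‖evalAlg x g‖ ≤ ‖g‖ :=
  ContinuousMap.norm_coe_le_norm g.1 x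

lemma norm_polyAlg_le (g : polyAlg Ω) {M : ℝ} (hM : 0 ≤ M) (h : ∀ x, ‖evalAlg x g‖ ≤ M) :
    ‖g‖ ≤ M := (ContinuousMap.norm_le g.1 hM).2 h

lemma evalAlg_ext {g h : polyAlg Ω} (H : ∀ x, evalAlg x g = evalAlg x h) : g = h :=
  Subtype.ext (ContinuousMap.ext H)

lemma exists_polyElt_near (g : polyAlg Ω) {ε : ℝ} (hε : 0 < ε) :
    ∃ P, ‖g - polyElt Ω P‖ < ε := by
  have := g.2
  unfold polyAlg at this
  rw [← SetLike.mem_coe, Subalgebra.topologicalClosure_coe, Metric.mem_closure_iff] at this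
  obtain ⟨_, ⟨P, rfl⟩, h⟩ := this ε hε
  exact ⟨P, by rw [dist_eq_norm] at h; exact h⟩

instance : NormedAlgebra ℚ (polyAlg Ω) := NormedAlgebra.restrictScalars ℚ ℂ _

lemma evalAlg_exp (x : Ω) (g : polyAlg Ω) :
    evalAlg x (NormedSpace.exp g) = Complex.exp (evalAlg x g) := by
  rw [Complex.exp_eq_exp_ℂ]
  exact NormedSpace.map_exp (evalAlg x) (continuous_evalAlg x) g

lemma InHull.evalAlg_le {K : Set (ℂ × ℂ)} {q : Ω} (h : InHull K q) (hK : K ⊆ Ω)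
    (g : polyAlg Ω) {M : ℝ}
    (hM : ∀ x : Ω, x.1 ∈ K → ‖evalAlg x g‖ ≤ M) : ‖evalAlg q g‖ ≤ M := by
  refine le_of_forall_pos_le_add fun ε hε => ?_
  obtain ⟨P, hP⟩ := exists_polyElt_near g (half_pos hε)
  have hd : ∀ x : Ω, ‖evalAlg x g - pev P x‖ < ε / 2 := by
    intro x
    have := norm_evalAlg_le x (g - polyElt Ω P)
    rw [map_sub, evalAlg_polyElt] at this
    exact this.trans_lt hP
  have h1 := h P (M + ε / 2) fun x hx => by
    have h1 := hM ⟨x, hK hx⟩ hx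
    have h2 := hd ⟨x, hK hx⟩
    have h3 := norm_sub_norm_le (pev P x) (evalAlg ⟨x, hK hx⟩ g)
    rw [norm_sub_rev] at h3
    dsimp only at h2
    linarith
  have h3 := norm_sub_norm_le (evalAlg q g) (pev P q)
  linarith [hd q]

end

lemma InHull.re_le {K : Set (ℂ × ℂ)} {q : ℂ × ℂ} (hK : IsCompact K) (h : InHull K q)
    (P : MvPolynomial (Fin 2) ℂ) {M : ℝ} (hM : ∀ x ∈ K, (pev P x).re ≤ M) : (pev P q).re ≤ M := by
  have : CompactSpace ↥(insert q K) := isCompact_iff_compactSpace.1 (hK.insert q)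
  have := InHull.evalAlg_le (Ω := insert q K) (q := ⟨q, Set.mem_insert _ _⟩) h
    (Set.subset_insert _ _) (NormedSpace.exp (polyElt _ P)) (M := Real.exp M) fun x hx => by
      rw [evalAlg_exp, evalAlg_polyElt, Complex.norm_exp]
      exact Real.exp_le_exp.2 (hM _ hx)
  rwa [evalAlg_exp, evalAlg_polyElt, Complex.norm_exp, Real.exp_le_exp] at this

lemma isUnit_of_norm_inv_le {R : Type*} [NormedRing R] [CompleteSpace R] [Nontrivial R]
    (u : Rˣ) {y : R} {c : ℝ} (hc : 0 < c) (hinv : ‖(↑u⁻¹ : R)‖ ≤ 2 / c) (h : ‖↑u - y‖ < c / 2) :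
    IsUnit y := by
  have hlt : ‖y - u‖ < ‖(↑u⁻¹ : R)‖⁻¹ := by
    rw [norm_sub_rev]
    refine h.trans_le ?_
    have hpos : 0 < ‖(↑u⁻¹ : R)‖ := norm_pos_iff.2 (Units.ne_zero _)
    rw [le_inv_comm₀ (by positivity) hpos, inv_div]
    exact hinv
  exact ⟨u.ofNearby _ hlt, rfl⟩

/-- Along a path in the uniform algebra that has no zeros on `K`, invertibility is preserved. -/
lemma InHull.isUnit_path {K : Set (ℂ × ℂ)} {q : ℂ × ℂ} (hK : IsCompact K) (h : InHull K q)
    [CompactSpace ↥(insert q K)] (γ : ℝ → polyAlg (insert q K)) (hγ : Continuous γ)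
    (h0 : IsUnit (γ 0))
    (hne : ∀ τ, ∀ x : ↥(insert q K), x.1 ∈ K → evalAlg x (γ τ) ≠ 0) (τ : ℝ) : IsUnit (γ τ) := by
  have hcl : IsClopen {τ | IsUnit (γ τ)} := by
    refine ⟨?_, Units.isOpen.preimage hγ⟩
    refine isClosed_of_closure_subset fun τ hτ => ?_
    obtain ⟨c, hc, hcK⟩ : ∃ c > 0, ∀ x : ↥(insert q K), x.1 ∈ K → c ≤ ‖evalAlg x (γ τ)‖ := by
      have hK' : IsCompact {x : ↥(insert q K) | x.1 ∈ K} :=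
        (hK.isClosed.preimage continuous_subtype_val).isCompact
      have hcont : Continuous fun x : ↥(insert q K) => ‖evalAlg x (γ τ)‖ :=
        (ContinuousMap.continuous (γ τ).1).norm
      obtain ⟨y, hy⟩ := h.nonempty
      obtain ⟨x, hx, hmin⟩ := hK'.exists_isMinOn ⟨⟨y, Set.mem_insert_of_mem _ hy⟩, hy⟩
        hcont.continuousOn
      exact ⟨_, norm_pos_iff.2 (hne τ x hx), fun z hz => hmin hz⟩
    have hnear := Metric.tendsto_nhds.1 (hγ.tendsto τ) (c / 2) (half_pos hc)
    obtain ⟨σ, hσ, hσ'⟩ := (mem_closure_iff_frequently.1 hτ |>.and_eventually hnear).exists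
    obtain ⟨u, hu⟩ := hσ
    rw [dist_eq_norm, ← hu] at hσ'
    have hinv : ‖(↑u⁻¹ : polyAlg (insert q K))‖ ≤ 2 / c := by
      have hb : ∀ x : ↥(insert q K), x.1 ∈ K →
          ‖evalAlg x (↑u⁻¹ : polyAlg (insert q K))‖ ≤ 2 / c := by
        intro x hx
        have h1 := hcK x hx
        have h2 := norm_evalAlg_le x (↑u - γ τ)
        rw [map_sub] at h2
        have h3 := norm_sub_norm_le (evalAlg x (γ τ)) (evalAlg x (↑u : polyAlg (insert q K)))
        rw [norm_sub_rev] at h3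
        have h4 : c / 2 ≤ ‖evalAlg x (↑u : polyAlg (insert q K))‖ := by linarith
        have h5 : evalAlg x (↑u⁻¹ : polyAlg (insert q K)) * evalAlg x ↑u = 1 := by
          rw [← map_mul, Units.inv_mul, map_one]
        have h6 : ‖evalAlg x (↑u⁻¹ : polyAlg (insert q K))‖ *
            ‖evalAlg x (↑u : polyAlg (insert q K))‖ = 1 := by
          rw [← norm_mul, h5, norm_one]
        rw [le_div_iff₀ hc]
        nlinarith [norm_nonneg (evalAlg x (↑u⁻¹ : polyAlg (insert q K)))]
      refine norm_polyAlg_le _ (by positivity) fun x => ?_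
      rcases x with ⟨x, hx⟩
      rcases Set.mem_insert_iff.1 hx with rfl | hx'
      · exact InHull.evalAlg_le (q := ⟨x, hx⟩) h (Set.subset_insert _ _) _ hb
      · exact hb _ hx'
    exact isUnit_of_norm_inv_le u hc hinv hσ'
  have := hcl.eq_univ ⟨0, h0⟩
  exact Set.eq_univ_iff_forall.1 this τ

lemma IsCompact.exists_pos_forall_le {X : Type*} [TopologicalSpace X] {K : Set X}
    (hK : IsCompact K) {f : X → ℝ} (hf : Continuous f) (h : ∀ x ∈ K, 0 < f x) :
    ∃ c > 0, ∀ x ∈ K, c ≤ f x := by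
  rcases K.eq_empty_or_nonempty with rfl | hne
  · exact ⟨1, one_pos, by simp⟩
  · obtain ⟨x, hx, hmin⟩ := hK.exists_isMinOn hne hf.continuousOn
    exact ⟨f x, h x hx, fun y hy => hmin hy⟩

lemma norm_exp_neg_I_mul (N : ℝ) (z : ℂ) :
    ‖Complex.exp (-(Complex.I * N) * z)‖ = Real.exp (N * z.im) := by
  rw [Complex.norm_exp]
  congr 1
  simp

lemma one_add_exp_ne_zero {N : ℝ} {z : ℂ} (hz : z.im = 0 → z = 0) :
    1 + Complex.exp (-(Complex.I * N) * z) ≠ 0 := by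
  intro h
  have h1 : Complex.exp (-(Complex.I * N) * z) = -1 := by linear_combination h
  have h2 := norm_exp_neg_I_mul N z
  rw [h1, norm_neg, norm_one, eq_comm, Real.exp_eq_one_iff] at h2
  rcases mul_eq_zero.1 h2 with h3 | h3
  · subst h3
    norm_num at h1
  · rw [hz h3] at h1
    norm_num at h1

lemma le_norm_one_add_exp {N c : ℝ} (hN : 0 < N) (hc : 0 < c) {z : ℂ}
    (hz : c * ‖z‖ ^ 2 ≤ |z.im|) :
    c / (N + c) ≤ ‖1 + Complex.exp (-(Complex.I * N) * z)‖ := by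
  by_cases hre : |N * z.re| ≤ 1
  · have h1 : (1 : ℝ) ≤ (1 + Complex.exp (-(Complex.I * N) * z)).re := by
      rw [Complex.add_re, Complex.exp_re]
      have : 0 ≤ Real.cos (-(Complex.I * N) * z).im := by
        have : (-(Complex.I * N) * z).im = -(N * z.re) := by simp
        rw [this, Real.cos_neg]
        have := abs_le.1 hre
        have := Real.pi_gt_three
        exact Real.cos_nonneg_of_neg_pi_div_two_le_of_le (by linarith) (by linarith)
      simp only [Complex.one_re]
      have := mul_nonneg (Real.exp_pos (-(Complex.I * N) * z).re).le this
      linarith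
    have h2 : c / (N + c) ≤ 1 := by
      rw [div_le_one (by positivity)]
      linarith
    exact h2.trans (h1.trans (Complex.re_le_norm _))
  · push Not at hre
    rw [abs_mul, abs_of_pos hN] at hre
    have h1 : 1 < N * ‖z‖ := hre.trans_le
      (mul_le_mul_of_nonneg_left (Complex.abs_re_le_norm z) hN.le)
    have h2 : c / N ≤ N * |z.im| := by
      rw [div_le_iff₀ hN]
      have : 1 ≤ (N * ‖z‖) ^ 2 := one_le_pow₀ h1.le
      nlinarith [mul_le_mul_of_nonneg_left hz (sq_nonneg N)]
    have h3 : |Real.exp (N * z.im) - 1| ≤ ‖1 + Complex.exp (-(Complex.I * N) * z)‖ := by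
      rw [← norm_exp_neg_I_mul]
      have := abs_norm_sub_norm_le (Complex.exp (-(Complex.I * N) * z)) (-1)
      rwa [norm_neg, norm_one, sub_neg_eq_add, add_comm _ (1 : ℂ)] at this
    refine le_trans ?_ h3
    have hcN : 0 < c / N := by positivity
    rcases le_total 0 z.im with hp | hn
    · rw [abs_of_nonneg hp] at h2
      have := Real.add_one_le_exp (N * z.im)
      have h4 : c / (N + c) ≤ c / N := div_le_div_of_nonneg_left hc.le hN (by linarith)
      exact le_trans (by linarith) (le_abs_self _)
    · rw [abs_of_nonpos hn] at h2
      have h5 := Real.add_one_le_exp (N * -z.im)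
      have h6 : Real.exp (N * z.im) * Real.exp (N * -z.im) = 1 := by
        rw [← Real.exp_add]
        simp
      have h7 : Real.exp (N * z.im) * (N + c) ≤ N := by
        have h8 : Real.exp (N * z.im) * (1 + c / N) ≤ 1 := by
          nlinarith [Real.exp_pos (N * z.im)]
        calc _ = Real.exp (N * z.im) * (1 + c / N) * N := by field_simp
          _ ≤ 1 * N := by gcongr
          _ = N := one_mul N
      have h9 : c / (N + c) ≤ 1 - Real.exp (N * z.im) := by
        rw [div_le_iff₀ (by positivity)]
        linarith
      exact h9.trans (by rw [abs_sub_comm]; exact le_abs_self _)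

/-- The element `1 + exp(-iNp)` of the uniform algebra. -/
def onePlusExp (Ω : Set (ℂ × ℂ)) [CompactSpace Ω] (p : MvPolynomial (Fin 2) ℂ) (N : ℝ) :
    polyAlg Ω :=
  1 + NormedSpace.exp ((-(Complex.I * N)) • polyElt Ω p)

lemma evalAlg_onePlusExp {Ω : Set (ℂ × ℂ)} [CompactSpace Ω] (x : Ω) (p) (N : ℝ) :
    evalAlg x (onePlusExp Ω p N) = 1 + Complex.exp (-(Complex.I * N) * pev p x) := by
  rw [onePlusExp, map_add, map_one, evalAlg_exp, map_smul, evalAlg_polyElt, smul_eq_mul]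

lemma InHull.isUnit_onePlusExp {K : Set (ℂ × ℂ)} {q : ℂ × ℂ} (hK : IsCompact K)
    (h : InHull K q) [CompactSpace ↥(insert q K)] (p : MvPolynomial (Fin 2) ℂ)
    (hp : ∀ x ∈ K, (pev p x).im = 0 → pev p x = 0) (N : ℝ) :
    IsUnit (onePlusExp (insert q K) p N) := by
  refine h.isUnit_path hK (fun N => onePlusExp (insert q K) p N) ?_ ?_ ?_ N
  · unfold onePlusExp
    refine continuous_const.add (NormedSpace.exp_continuous.comp ?_)
    fun_prop
  · have : onePlusExp (insert q K) p 0 = algebraMap ℂ _ 2 := by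
      refine evalAlg_ext fun x => ?_
      rw [evalAlg_onePlusExp, AlgHom.commutes]
      norm_num
    rw [this]
    exact (IsUnit.mk0 (2 : ℂ) two_ne_zero).map _
  · intro N x hx
    rw [evalAlg_onePlusExp]
    exact one_add_exp_ne_zero (hp x hx)

lemma InHull.im_ne_zero {K : Set (ℂ × ℂ)} {q : ℂ × ℂ} (hK : IsCompact K)
    (h : InHull K q) (p : MvPolynomial (Fin 2) ℂ)
    (hp : ∀ x ∈ K, (pev p x).im = 0 → pev p x = 0) (hq : pev p q ≠ 0) : (pev p q).im ≠ 0 := by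
  intro him
  have : CompactSpace ↥(insert q K) := isCompact_iff_compactSpace.1 (hK.insert q)
  have hre : (pev p q).re ≠ 0 := fun h0 => hq (Complex.ext h0 him)
  have hu := (h.isUnit_onePlusExp hK p hp (Real.pi / (pev p q).re)).map
    (evalAlg ⟨q, Set.mem_insert _ _⟩)
  rw [evalAlg_onePlusExp] at hu
  refine hu.ne_zero ?_
  have h1 : -(Complex.I * ((Real.pi / (pev p q).re : ℝ) : ℂ)) * pev p q =
      -(Real.pi * Complex.I) := by
    have h2 : pev p q = ((pev p q).re : ℂ) := Complex.ext rfl (by simp [him])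
    have h3 : ((pev p q).re : ℂ) ≠ 0 := by exact_mod_cast hre
    generalize (pev p q).re = r at *
    rw [h2]
    push_cast
    field_simp
  rw [h1, Complex.exp_neg, Complex.exp_pi_mul_I]
  norm_num

lemma kallin_numeric {C δ c Λ : ℝ} (hC : 1 ≤ C) (hδ : 0 ≤ δ) (hδ' : δ < 1) (hc : 0 < c) :
    ∃ k : ℕ, 1 ≤ k ∧ δ ^ k * ((Λ * k + c) / c) ≤ 1 / 4 ∧ C ^ k / ((4 * C) ^ k - 1) ≤ 1 / 4 := by
  have t1 : Filter.Tendsto (fun k : ℕ => δ ^ k * ((Λ * k + c) / c)) Filter.atTop (nhds 0) := by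
    have e : (fun k : ℕ => δ ^ k * ((Λ * k + c) / c)) =
        fun k : ℕ => Λ / c * ((k : ℝ) * δ ^ k) + δ ^ k := by
      funext k
      field_simp
    rw [e]
    have a1 := tendsto_self_mul_const_pow_of_lt_one hδ hδ'
    have a2 := tendsto_pow_atTop_nhds_zero_of_lt_one hδ hδ'
    simpa using (a1.const_mul (Λ / c)).add a2
  obtain ⟨k, hk, hk2⟩ := ((t1.eventually (gt_mem_nhds (show (0 : ℝ) < 1 / 4 by norm_num))).and
    (Filter.eventually_ge_atTop 2)).exists
  refine ⟨k, by omega, hk.le, ?_⟩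
  have h1 : (1 : ℝ) ≤ C ^ k := one_le_pow₀ hC
  have h2 : (16 : ℝ) ≤ 4 ^ k := by
    calc (16 : ℝ) = 4 ^ 2 := by norm_num
      _ ≤ 4 ^ k := pow_le_pow_right₀ (by norm_num) hk2
  rw [mul_pow, div_le_iff₀ (by nlinarith)]
  nlinarith

/-- The lower half of Kallin's lemma. -/
lemma InHull.of_im_neg {X1 X2 : Set (ℂ × ℂ)} (h1 : IsCompact X1) (h2 : IsCompact X2)
    (hne : X1.Nonempty) (p : MvPolynomial (Fin 2) ℂ) {c : ℝ} (hc : 0 < c)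
    (hX1 : ∀ x ∈ X1, c * ‖pev p x‖ ^ 2 ≤ -(pev p x).im)
    (hX2 : ∀ x ∈ X2, c * ‖pev p x‖ ^ 2 ≤ (pev p x).im)
    (hz : ∀ x ∈ X2, pev p x = 0 → x ∈ X1) {q : ℂ × ℂ} (h : InHull (X1 ∪ X2) q)
    (hq : (pev p q).im < 0) : InHull X1 q := by
  by_contra hcon
  have hK := h1.union h2
  have hcs : CompactSpace ↥(insert q (X1 ∪ X2)) := isCompact_iff_compactSpace.1 (hK.insert q)
  obtain ⟨f, δ, hδ0, hδ1, hfX, hfq⟩ : ∃ (f : MvPolynomial (Fin 2) ℂ) (δ : ℝ), 0 ≤ δ ∧ δ < 1 ∧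
      (∀ x ∈ X1, ‖pev f x‖ ≤ δ) ∧ pev f q = 1 := by
    unfold InHull at hcon
    push Not at hcon
    obtain ⟨P, M, hPM, hPq⟩ := hcon
    obtain ⟨y, hy⟩ := hne
    have hM : 0 ≤ M := (norm_nonneg _).trans (hPM y hy)
    have hpos : 0 < ‖pev P q‖ := hM.trans_lt hPq
    refine ⟨MvPolynomial.C (pev P q)⁻¹ * P, M / ‖pev P q‖, by positivity, ?_, ?_, ?_⟩
    · rwa [div_lt_one hpos]
    · intro x hx
      rw [pev_mul, pev_C, norm_mul, norm_inv, div_eq_inv_mul]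
      gcongr
      exact hPM x hx
    · rw [pev_mul, pev_C]
      exact inv_mul_cancel₀ (norm_pos_iff.1 hpos)
  obtain ⟨C, hC1, hC⟩ : ∃ C : ℝ, 1 ≤ C ∧ ∀ x ∈ X1 ∪ X2, ‖pev f x‖ ≤ C := by
    obtain ⟨C, hC⟩ := (hK.image (continuous_pev f).norm).bddAbove
    exact ⟨max 1 C, le_max_left _ _, fun x hx => (hC ⟨x, hx, rfl⟩).trans (le_max_right _ _)⟩
  have hzero : ∀ x ∈ X1 ∪ X2, (pev p x).im = 0 → pev p x = 0 := by
    intro x hx h0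
    have : c * ‖pev p x‖ ^ 2 ≤ 0 := by
      rcases hx with hx | hx
      · simpa [h0] using hX1 x hx
      · simpa [h0] using hX2 x hx
    have h3 : ‖pev p x‖ ^ 2 ≤ 0 := by
      by_contra! h4
      nlinarith
    exact norm_eq_zero.1 (pow_eq_zero_iff two_ne_zero |>.1 (le_antisymm h3 (sq_nonneg _)))
  set δ' := (1 + δ) / 2 with hδ'
  have hcpt : IsCompact (X2 ∩ {x | δ' ≤ ‖pev f x‖}) :=
    h2.inter_right (isClosed_le continuous_const (continuous_pev f).norm)
  obtain ⟨η, hη, hηX⟩ := hcpt.exists_pos_forall_le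
    (Complex.continuous_im.comp (continuous_pev p)) (by
      rintro x ⟨hx, hx'⟩
      have h4 := hX2 x hx
      have h5 : (0 : ℝ) ≤ (pev p x).im := le_trans (by positivity) h4
      refine h5.lt_of_ne fun h6 => ?_
      have h7 := hfX x (hz x hx (hzero x (Or.inr hx) h6.symm))
      have h8 : δ' ≤ ‖pev f x‖ := hx'
      linarith)
  set Λ := 4 * C / η with hΛ
  have hΛ0 : 0 < Λ := by positivity
  obtain ⟨k, hk1, hk2, hk3⟩ := kallin_numeric (C := C) (δ := δ') (c := c) (Λ := Λ) hC1
    (by positivity) (by linarith) hc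
  have hkpos : (0 : ℝ) < k := by exact_mod_cast hk1
  set N : ℝ := Λ * k with hN
  have hN0 : 0 < N := by positivity
  obtain ⟨u, hu⟩ := h.isUnit_onePlusExp hK p hzero N
  have hinv : ∀ x, evalAlg x (↑u⁻¹ : polyAlg (insert q (X1 ∪ X2))) =
      (1 + Complex.exp (-(Complex.I * N) * pev p x))⁻¹ := by
    intro x
    rw [← evalAlg_onePlusExp, ← hu]
    refine eq_inv_of_mul_eq_one_left ?_
    rw [← map_mul, Units.inv_mul, map_one]
  set g : polyAlg (insert q (X1 ∪ X2)) :=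
    polyElt (insert q (X1 ∪ X2)) f ^ k * (↑u⁻¹ : polyAlg (insert q (X1 ∪ X2))) with hg
  have hgv : ∀ x, ‖evalAlg x g‖ =
      ‖pev f x‖ ^ k * ‖1 + Complex.exp (-(Complex.I * N) * pev p x)‖⁻¹ := by
    intro x
    rw [hg, map_mul, map_pow, hinv, evalAlg_polyElt, norm_mul, norm_pow, norm_inv]
  have hgK : ∀ x : ↥(insert q (X1 ∪ X2)), x.1 ∈ X1 ∪ X2 → ‖evalAlg x g‖ ≤ 1 / 4 := by
    intro x hx
    rw [hgv]
    by_cases hfx : ‖pev f x‖ ≤ δ'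
    · refine le_trans ?_ hk2
      have h4 : c * ‖pev p x‖ ^ 2 ≤ |(pev p x).im| := by
        rcases hx with hx | hx
        · exact (hX1 x hx).trans (neg_le_abs _)
        · exact (hX2 x hx).trans (le_abs_self _)
      have h5 := le_norm_one_add_exp hN0 hc h4
      have h6 : ‖1 + Complex.exp (-(Complex.I * N) * pev p x)‖⁻¹ ≤ (N + c) / c := by
        rw [← inv_div]
        exact inv_anti₀ (by positivity) h5
      gcongr
    · push Not at hfx
      have hx2 : x.1 ∈ X2 := by
        rcases hx with hx | hx
        · have := hfX x hx
          linarith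
        · exact hx
      have h4 : η ≤ (pev p x).im := hηX x ⟨hx2, hfx.le⟩
      have h5 : (4 * C) ^ k ≤ Real.exp (N * (pev p x).im) := by
        have h6 : 4 * C ≤ Real.exp (Λ * η) := by
          have : Λ * η = 4 * C := by rw [hΛ]; field_simp
          rw [this]
          linarith [Real.add_one_le_exp (4 * C)]
        calc (4 * C) ^ k ≤ Real.exp (Λ * η) ^ k := by gcongr
          _ = Real.exp (N * η) := by rw [← Real.exp_nat_mul]; congr 1; rw [hN]; ring
          _ ≤ _ := by gcongr
      have h7 : (4 * C) ^ k - 1 ≤ ‖1 + Complex.exp (-(Complex.I * N) * pev p x)‖ := by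
        have := norm_sub_norm_le (Complex.exp (-(Complex.I * N) * pev p x)) (-1)
        rw [norm_neg, norm_one, sub_neg_eq_add, add_comm _ (1 : ℂ), norm_exp_neg_I_mul] at this
        linarith
      have h8 : 0 < (4 * C) ^ k - 1 := by
        have : 1 < (4 * C) ^ k := one_lt_pow₀ (by linarith) (by omega)
        linarith
      refine le_trans ?_ hk3
      rw [div_eq_mul_inv]
      have := hC x hx
      gcongr
  have hgq := h.evalAlg_le (q := ⟨q, Set.mem_insert _ _⟩) (Set.subset_insert _ _) g hgK
  rw [hgv] at hgq
  simp only [hfq, norm_one, one_pow, one_mul] at hgq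
  have h9 : ‖1 + Complex.exp (-(Complex.I * N) * pev p q)‖ ≤ 2 := by
    refine (norm_add_le _ _).trans ?_
    rw [norm_exp_neg_I_mul, norm_one]
    have : Real.exp (N * (pev p q).im) ≤ 1 := Real.exp_le_one_iff.2 (by nlinarith)
    linarith
  have h10 : 0 < ‖1 + Complex.exp (-(Complex.I * N) * pev p q)‖ := by
    rw [norm_pos_iff]
    exact one_add_exp_ne_zero fun h0 => absurd h0 hq.ne
  rw [inv_le_comm₀ h10 (by norm_num)] at hgq
  have := hgq.trans h9
  norm_num at this

/-- A version of Kallin's lemma for two compact sets that meet where `p` vanishes. -/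
theorem InHull.kallin {X1 X2 : Set (ℂ × ℂ)} (h1 : IsCompact X1) (h2 : IsCompact X2)
    (hne1 : X1.Nonempty) (hne2 : X2.Nonempty) (p : MvPolynomial (Fin 2) ℂ) {c : ℝ} (hc : 0 < c)
    (hX1 : ∀ x ∈ X1, c * ‖pev p x‖ ^ 2 ≤ -(pev p x).im)
    (hX2 : ∀ x ∈ X2, c * ‖pev p x‖ ^ 2 ≤ (pev p x).im)
    (hz : ∀ x ∈ X1 ∪ X2, pev p x = 0 → x ∈ X1 ∩ X2) {q : ℂ × ℂ} (h : InHull (X1 ∪ X2) q)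
    (hq : pev p q ≠ 0) : InHull X1 q ∨ InHull X2 q := by
  have him : (pev p q).im ≠ 0 := by
    refine h.im_ne_zero (h1.union h2) p ?_ hq
    intro x hx h0
    by_contra hx0
    have h3 : 0 < c * ‖pev p x‖ ^ 2 := by
      have := norm_pos_iff.2 hx0
      positivity
    rcases hx with hx | hx
    · linarith [hX1 x hx]
    · linarith [hX2 x hx]
  rcases lt_or_gt_of_ne him with hlt | hgt
  · exact Or.inl (h.of_im_neg h1 h2 hne1 p hc hX1 hX2 (fun x hx h0 => (hz x (Or.inr hx) h0).1) hlt)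
  · right
    rw [Set.union_comm] at h
    refine h.of_im_neg h2 h1 hne2 (-p) hc ?_ ?_ ?_ ?_
    · simpa using hX2
    · simpa using hX1
    · intro x hx h0
      exact (hz x (Or.inl hx) (by simpa using h0)).2
    · simpa using hgt

/-- A compact set that is a shear of a graph over a real box, with slope at most one in the
imaginary directions, contains its polynomial hull. -/
lemma InHull.mem_graph {D : Set (ℝ × ℝ)} {a b : ℝ × ℝ → ℂ} {k : ℂ} {r : ℝ}
    (hcpt : IsCompact ((fun x => (a x, b x)) '' D))
    (ha : ∀ x ∈ D, |(a x - k * b x).re| ≤ r) (hb : ∀ x ∈ D, |(b x).re| ≤ r)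
    (hsurj : ∀ ξ : ℝ × ℝ, |ξ.1| ≤ r → |ξ.2| ≤ r →
      ∃ x ∈ D, (a x - k * b x).re = ξ.1 ∧ (b x).re = ξ.2)
    (hlip : ∀ x ∈ D, ∀ y ∈ D,
      ((a x - k * b x).im - (a y - k * b y).im) ^ 2 + ((b x).im - (b y).im) ^ 2 ≤
      ((a x - k * b x).re - (a y - k * b y).re) ^ 2 + ((b x).re - (b y).re) ^ 2)
    {q : ℂ × ℂ} (h : InHull ((fun x => (a x, b x)) '' D) q) :
    q ∈ (fun x => (a x, b x)) '' D := by
  have habs : ∀ (P : MvPolynomial (Fin 2) ℂ), (∀ x ∈ D, |(pev P (a x, b x)).re| ≤ r) →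
      |(pev P q).re| ≤ r := by
    intro P hP
    rw [abs_le]
    constructor
    · have := h.re_le hcpt (-P) (M := r) (by
        rintro _ ⟨x, hx, rfl⟩
        rw [pev_neg, Complex.neg_re]
        exact (neg_le_abs _).trans (hP x hx))
      rw [pev_neg, Complex.neg_re] at this
      linarith
    · exact h.re_le hcpt P (by
        rintro _ ⟨x, hx, rfl⟩
        exact (le_abs_self _).trans (hP x hx))
  have q1 := habs (MvPolynomial.X 0 - MvPolynomial.C k * MvPolynomial.X 1) (by simpa using ha)
  have q2 := habs (MvPolynomial.X 1) (by simpa using hb)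
  simp only [pev_sub, pev_mul, pev_C, pev_X0, pev_X1] at q1 q2
  obtain ⟨x, hx, e1, e2⟩ := hsurj ((q.1 - k * q.2).re, q.2.re) q1 q2
  have hG := h.re_le hcpt (-((MvPolynomial.X 0 - MvPolynomial.C k * MvPolynomial.X 1
      - MvPolynomial.C (a x - k * b x)) ^ 2 + (MvPolynomial.X 1 - MvPolynomial.C (b x)) ^ 2))
      (M := 0) (by
    rintro _ ⟨y, hy, rfl⟩
    have := hlip y hy x hx
    simp only [pev_sub, pev_neg, pev_add, pev_pow, pev_mul, pev_C, pev_X0, pev_X1]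
    generalize a y - k * b y = A at *
    generalize a x - k * b x = A' at *
    simp only [Complex.neg_re, Complex.add_re, sq, Complex.mul_re, Complex.sub_re,
      Complex.sub_im] at *
    linarith)
  simp only [pev_sub, pev_neg, pev_add, pev_pow, pev_mul, pev_C, pev_X0, pev_X1] at hG
  dsimp only at e1 e2
  refine ⟨x, hx, ?_⟩
  have key : q.1 - k * q.2 = a x - k * b x ∧ q.2 = b x := by
    generalize a x - k * b x = A at *
    generalize q.1 - k * q.2 = Q at *
    simp only [Complex.neg_re, Complex.add_re, sq, Complex.mul_re, Complex.sub_re,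
      Complex.sub_im, e1, e2] at hG
    constructor
    · refine Complex.ext e1.symm ?_
      nlinarith [sq_nonneg (Q.im - A.im), sq_nonneg (q.2.im - (b x).im)]
    · refine Complex.ext e2.symm ?_
      nlinarith [sq_nonneg (Q.im - A.im), sq_nonneg (q.2.im - (b x).im)]
  obtain ⟨k1, k2⟩ := key
  rw [k2] at k1
  refine Prod.ext ?_ k2.symm
  simp only
  linear_combination -k1

/-- The parameter domain over the real box of radius `ρ / 2`. -/
def boxDomain (A b : ℝ × ℝ → ℂ) (ρ : ℝ) : Set (ℝ × ℝ) :=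
  closedBall 0 ρ ∩ {x | |(A x).re| ≤ ρ / 2 ∧ |(b x).re| ≤ ρ / 2}

/-- `A - fst` and `b - snd` are `1/4`-Lipschitz on the ball of radius `ρ`. -/
structure NearId (A b : ℝ × ℝ → ℂ) (ρ : ℝ) : Prop where
  zero_fst : A 0 = 0
  zero_snd : b 0 = 0
  fst : ∀ x ∈ closedBall (0 : ℝ × ℝ) ρ, ∀ y ∈ closedBall (0 : ℝ × ℝ) ρ,
    ‖(A x - x.1) - (A y - y.1)‖ ≤ 1 / 4 * ‖x - y‖
  snd : ∀ x ∈ closedBall (0 : ℝ × ℝ) ρ, ∀ y ∈ closedBall (0 : ℝ × ℝ) ρ,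
    ‖(b x - x.2) - (b y - y.2)‖ ≤ 1 / 4 * ‖x - y‖

lemma NearId.mono {A b : ℝ × ℝ → ℂ} {ρ ρ' : ℝ} (h : NearId A b ρ) (hle : ρ' ≤ ρ) :
    NearId A b ρ' :=
  ⟨h.zero_fst, h.zero_snd,
    fun x hx y hy => h.fst x (closedBall_subset_closedBall hle hx) y
      (closedBall_subset_closedBall hle hy),
    fun x hx y hy => h.snd x (closedBall_subset_closedBall hle hx) y
      (closedBall_subset_closedBall hle hy)⟩

lemma continuousOn_of_sub_lipschitz {A : ℝ × ℝ → ℂ} {f : ℝ × ℝ → ℂ} (hf : Continuous f)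
    {s : Set (ℝ × ℝ)} (h : ∀ x ∈ s, ∀ y ∈ s, ‖(A x - f x) - (A y - f y)‖ ≤ 1 / 4 * ‖x - y‖) :
    ContinuousOn A s := by
  have h1 : LipschitzOnWith (1 / 4) (fun x => A x - f x) s :=
    LipschitzOnWith.of_dist_le_mul fun x hx y hy => by
      rw [dist_eq_norm, dist_eq_norm]
      simpa using h x hx y hy
  refine (h1.continuousOn.add hf.continuousOn).congr fun x _ => ?_
  simp

lemma NearId.continuousOn_fst {A b : ℝ × ℝ → ℂ} {ρ : ℝ} (h : NearId A b ρ) :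
    ContinuousOn A (closedBall 0 ρ) :=
  continuousOn_of_sub_lipschitz (f := fun x => (x.1 : ℂ)) (by fun_prop) h.fst

lemma NearId.continuousOn_snd {A b : ℝ × ℝ → ℂ} {ρ : ℝ} (h : NearId A b ρ) :
    ContinuousOn b (closedBall 0 ρ) :=
  continuousOn_of_sub_lipschitz (f := fun x => (x.2 : ℂ)) (by fun_prop) h.snd

lemma NearId.isCompact_boxDomain {A b : ℝ × ℝ → ℂ} {ρ : ℝ} (h : NearId A b ρ) :
    IsCompact (boxDomain A b ρ) := by
  have h1 : IsClosed (boxDomain A b ρ) := by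
    have : boxDomain A b ρ = (closedBall 0 ρ ∩ (fun x => |(A x).re|) ⁻¹' Set.Iic (ρ / 2)) ∩
        (closedBall 0 ρ ∩ (fun x => |(b x).re|) ⁻¹' Set.Iic (ρ / 2)) := by
      ext x
      simp only [boxDomain, Set.mem_inter_iff, Set.mem_ofPred_eq, Set.mem_preimage, Set.mem_Iic]
      tauto
    rw [this]
    exact ((Complex.continuous_re.comp_continuousOn h.continuousOn_fst).abs
        |>.preimage_isClosed_of_isClosed isClosed_closedBall isClosed_Iic).inter
      ((Complex.continuous_re.comp_continuousOn h.continuousOn_snd).abs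
        |>.preimage_isClosed_of_isClosed isClosed_closedBall isClosed_Iic)
  exact (isCompact_closedBall _ _).of_isClosed_subset h1 Set.inter_subset_left

lemma NearId.zero_mem {A b : ℝ × ℝ → ℂ} {ρ : ℝ} (h : NearId A b ρ) (hρ : 0 < ρ) :
    0 ∈ boxDomain A b ρ := by
  refine ⟨mem_closedBall_self hρ.le, ?_⟩
  simp [h.zero_fst, h.zero_snd, (half_pos hρ).le]

lemma NearId.mem_nhds {A b : ℝ × ℝ → ℂ} {ρ : ℝ} (h : NearId A b ρ) (hρ : 0 < ρ) :
    boxDomain A b ρ ∈ nhds 0 := by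
  have hball : closedBall (0 : ℝ × ℝ) ρ ∈ nhds 0 := closedBall_mem_nhds _ hρ
  have h1 := (Complex.continuous_re.comp_continuousOn h.continuousOn_fst).abs.continuousAt hball
  have h2 := (Complex.continuous_re.comp_continuousOn h.continuousOn_snd).abs.continuousAt hball
  have e1 := h1.eventually (gt_mem_nhds (show |(A 0).re| < ρ / 2 by simpa [h.zero_fst] using hρ))
  have e2 := h2.eventually (gt_mem_nhds (show |(b 0).re| < ρ / 2 by simpa [h.zero_snd] using hρ))
  filter_upwards [hball, e1, e2] with x hx h3 h4
  exact ⟨hx, h3.le, h4.le⟩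

lemma NearId.surj {A b : ℝ × ℝ → ℂ} {ρ : ℝ} (h : NearId A b ρ) (hρ : 0 < ρ) (ξ : ℝ × ℝ)
    (h1 : |ξ.1| ≤ ρ / 2) (h2 : |ξ.2| ≤ ρ / 2) :
    ∃ x ∈ boxDomain A b ρ, (A x).re = ξ.1 ∧ (b x).re = ξ.2 := by
  set f : ℝ × ℝ → ℝ × ℝ := fun x => (ξ.1 - (A x - x.1).re, ξ.2 - (b x - x.2).re) with hf
  have hlip : ∀ x ∈ closedBall (0 : ℝ × ℝ) ρ, ∀ y ∈ closedBall (0 : ℝ × ℝ) ρ,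
      dist (f x) (f y) ≤ 1 / 4 * dist x y := by
    intro x hx y hy
    rw [dist_eq_norm, dist_eq_norm, hf, Prod.norm_def]
    refine max_le ?_ ?_
    · refine le_trans ?_ (h.fst x hx y hy)
      have : ((ξ.1 - (A x - x.1).re, ξ.2 - (b x - x.2).re) -
        (ξ.1 - (A y - y.1).re, ξ.2 - (b y - y.2).re) : ℝ × ℝ).1 =
          -((A x - x.1) - (A y - y.1)).re := by simp
      rw [this, norm_neg]
      exact Complex.abs_re_le_norm _
    · refine le_trans ?_ (h.snd x hx y hy)
      have : ((ξ.1 - (A x - x.1).re, ξ.2 - (b x - x.2).re) -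
        (ξ.1 - (A y - y.1).re, ξ.2 - (b y - y.2).re) : ℝ × ℝ).2 =
          -((b x - x.2) - (b y - y.2)).re := by simp
      rw [this, norm_neg]
      exact Complex.abs_re_le_norm _
  have h0 : (0 : ℝ × ℝ) ∈ closedBall (0 : ℝ × ℝ) ρ := mem_closedBall_self hρ.le
  have hmaps : Set.MapsTo f (closedBall 0 ρ) (closedBall 0 ρ) := by
    intro x hx
    have e1 := hlip x hx 0 h0
    have e2 : dist (f 0) 0 ≤ ρ / 2 := by
      rw [dist_zero_right, hf, Prod.norm_def]
      simp only [h.zero_fst, h.zero_snd]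
      simpa using ⟨h1, h2⟩
    have e3 := dist_triangle (f x) (f 0) 0
    rw [mem_closedBall] at hx ⊢
    linarith
  have hcontr : ContractingWith (1 / 4) (hmaps.restrict f _ _) := by
    refine ⟨?_, LipschitzWith.of_dist_le_mul fun x y => ?_⟩
    · rw [← NNReal.coe_lt_coe]
      norm_num
    · exact_mod_cast hlip x.1 x.2 y.1 y.2
  obtain ⟨x, hx, hfix, -⟩ := hcontr.exists_fixedPoint' isClosed_closedBall.isComplete hmaps h0
    (edist_ne_top _ _)
  have e1 : f x = x := hfix
  have e2 := congrArg Prod.fst e1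
  have e3 := congrArg Prod.snd e1
  simp only [hf, Complex.sub_re, Complex.ofReal_re] at e2 e3
  have e4 : (A x).re = ξ.1 := by linarith
  have e5 : (b x).re = ξ.2 := by linarith
  exact ⟨x, ⟨hx, by rwa [e4], by rwa [e5]⟩, e4, e5⟩

lemma NearId.im_le_re {A b : ℝ × ℝ → ℂ} {ρ : ℝ} (h : NearId A b ρ) {x y : ℝ × ℝ}
    (hx : x ∈ closedBall 0 ρ) (hy : y ∈ closedBall 0 ρ) :
    ((A x).im - (A y).im) ^ 2 + ((b x).im - (b y).im) ^ 2 ≤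
      ((A x).re - (A y).re) ^ 2 + ((b x).re - (b y).re) ^ 2 := by
  have h1 := h.fst x hx y hy
  have h2 := h.snd x hx y hy
  set d := ‖x - y‖ with hd
  have hd0 : 0 ≤ d := norm_nonneg _
  have i1 : |(A x).im - (A y).im| ≤ 1 / 4 * d := by
    refine le_trans ?_ h1
    have := Complex.abs_im_le_norm ((A x - x.1) - (A y - y.1))
    simpa using this
  have i2 : |(b x).im - (b y).im| ≤ 1 / 4 * d := by
    refine le_trans ?_ h2
    have := Complex.abs_im_le_norm ((b x - x.2) - (b y - y.2))
    simpa using this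
  have r1 : |((A x).re - x.1) - ((A y).re - y.1)| ≤ 1 / 4 * d := by
    refine le_trans ?_ h1
    have := Complex.abs_re_le_norm ((A x - x.1) - (A y - y.1))
    simpa using this
  have r2 : |((b x).re - x.2) - ((b y).re - y.2)| ≤ 1 / 4 * d := by
    refine le_trans ?_ h2
    have := Complex.abs_re_le_norm ((b x - x.2) - (b y - y.2))
    simpa using this
  have j1 : ((A x).im - (A y).im) ^ 2 ≤ (1 / 4 * d) ^ 2 := sq_le_sq' (abs_le.1 i1).1 (abs_le.1 i1).2
  have j2 : ((b x).im - (b y).im) ^ 2 ≤ (1 / 4 * d) ^ 2 := sq_le_sq' (abs_le.1 i2).1 (abs_le.1 i2).2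
  have hdd : d = |x.1 - y.1| ∨ d = |x.2 - y.2| := by
    rw [hd, Prod.norm_def]
    exact (max_choice _ _)
  have hlow : ∀ {u v : ℝ}, |u - v| ≤ 1 / 4 * d → d = |v| → (3 / 4 * d) ^ 2 ≤ u ^ 2 := by
    intro u v huv hv
    rw [← sq_abs u]
    refine pow_le_pow_left₀ (by positivity) ?_ 2
    have := abs_sub_abs_le_abs_sub v u
    rw [abs_sub_comm] at this
    linarith
  rcases hdd with hdd | hdd
  · have := hlow (u := (A x).re - (A y).re) (v := x.1 - y.1) (by convert r1 using 2; ring) hdd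
    nlinarith [sq_nonneg ((b x).re - (b y).re)]
  · have := hlow (u := (b x).re - (b y).re) (v := x.2 - y.2) (by convert r2 using 2; ring) hdd
    nlinarith [sq_nonneg ((A x).re - (A y).re)]

/-- Polynomial convexity of the two-sheeted set cut out by `(a ^ 2, b)`. -/
theorem InHull.mem_two_sheets {F : ℝ × ℝ → ℂ × ℂ} {a b : ℝ × ℝ → ℂ} {k : ℂ} {ρ : ℝ} (hρ : 0 < ρ)
    {T1 T2 : MvPolynomial (Fin 2) ℂ}
    (hT : Function.Injective fun x => (pev T1 x, pev T2 x))
    (hTF : ∀ x, (pev T1 (F x), pev T2 (F x)) = (a x ^ 2, b x))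
    (hnear : NearId (fun x => a x - k * b x) b ρ) {c : ℝ} (hc : 0 < c)
    (s : Set (MvPolynomial (Fin 2) ℂ))
    (hs1 : ∀ p ∈ s, ∀ x ∈ closedBall (0 : ℝ × ℝ) ρ,
      c * ‖pev p (a x, b x)‖ ^ 2 ≤ -(pev p (a x, b x)).im)
    (hs2 : ∀ p ∈ s, ∀ x ∈ closedBall (0 : ℝ × ℝ) ρ,
      c * ‖pev p (-a x, b x)‖ ^ 2 ≤ (pev p (-a x, b x)).im)
    (hs0 : ∀ p ∈ s, ∀ x ∈ closedBall (0 : ℝ × ℝ) ρ,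
      pev p (a x, b x) = 0 ∨ pev p (-a x, b x) = 0 → x = 0)
    (hsq : ∀ q, (∀ p ∈ s, pev p q = 0) → q = 0) {q : ℂ × ℂ}
    (h : InHull (F '' boxDomain (fun x => a x - k * b x) b ρ) q) :
    q ∈ F '' boxDomain (fun x => a x - k * b x) b ρ := by
  set D := boxDomain (fun x => a x - k * b x) b ρ with hD
  have hDsub : D ⊆ closedBall 0 ρ := Set.inter_subset_left
  have hb0 : b 0 = 0 := hnear.zero_snd
  have ha0 : a 0 = 0 := by simpa [hb0] using hnear.zero_fst
  have hca : ContinuousOn a (closedBall 0 ρ) := by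
    refine (hnear.continuousOn_fst.add
      ((continuousOn_const (c := k)).mul hnear.continuousOn_snd)).congr fun x _ => ?_
    simp
  have hDc : IsCompact D := hnear.isCompact_boxDomain
  have hD0 : (0 : ℝ × ℝ) ∈ D := hnear.zero_mem hρ
  set X1 := (fun x => (a x, b x)) '' D with hX1
  set X2 := (fun x => (-a x, b x)) '' D with hX2
  have hX1c : IsCompact X1 :=
    hDc.image_of_continuousOn ((hca.mono hDsub).prodMk (hnear.continuousOn_snd.mono hDsub))
  have hX2c : IsCompact X2 :=
    hDc.image_of_continuousOn ((hca.mono hDsub).neg.prodMk (hnear.continuousOn_snd.mono hDsub))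
  have hz1 : (0 : ℂ × ℂ) ∈ X1 := ⟨0, hD0, by simp [ha0, hb0]⟩
  have hz2 : (0 : ℂ × ℂ) ∈ X2 := ⟨0, hD0, by simp [ha0, hb0]⟩
  have sheet : ∀ {q}, InHull X1 q → q ∈ X1 := fun h' =>
    h'.mem_graph (r := ρ / 2) (k := k) hX1c (fun x hx => hx.2.1) (fun x hx => hx.2.2)
      (fun ξ h1 h2 => hnear.surj hρ ξ h1 h2)
      (fun x hx y hy => hnear.im_le_re (hDsub hx) (hDsub hy))
  have sheet2 : ∀ {q}, InHull X2 q → q ∈ X2 := by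
    intro q h'
    have h2 := h'.map (-MvPolynomial.X 0) (MvPolynomial.X 1)
    have e : (fun x => (pev (-MvPolynomial.X 0) x, pev (MvPolynomial.X 1) x)) '' X2 = X1 := by
      rw [hX2, hX1, Set.image_image]
      simp
    rw [e] at h2
    obtain ⟨x, hx, e⟩ := sheet h2
    simp only [pev_neg, pev_X0, pev_X1, Prod.mk.injEq] at e
    exact ⟨x, hx, Prod.ext (by simp [e.1]) e.2⟩
  have hTq := h.map T1 T2
  obtain ⟨α, hα⟩ := IsAlgClosed.exists_pow_nat_eq (pev T1 q) (n := 2) (by norm_num)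
  rw [← hα] at hTq
  have hlift := hTq.sqrt_lift
  have hsub : {x : ℂ × ℂ | (x.1 ^ 2, x.2) ∈
      (fun x => (pev T1 x, pev T2 x)) '' (F '' D)} = X1 ∪ X2 := by
    ext ⟨u, v⟩
    rw [Set.image_image]
    simp only [hTF, Set.mem_ofPred_eq, Set.mem_image, Prod.mk.injEq, hX1, hX2, Set.mem_union]
    constructor
    · rintro ⟨x, hx, e1, e2⟩
      rcases sq_eq_sq_iff_eq_or_eq_neg.1 e1 with e | e
      · exact Or.inl ⟨x, hx, e, e2⟩
      · exact Or.inr ⟨x, hx, by simp [e], e2⟩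
    · rintro (⟨x, hx, rfl, e2⟩ | ⟨x, hx, rfl, e2⟩)
      · exact ⟨x, hx, rfl, e2⟩
      · exact ⟨x, hx, by ring, e2⟩
  rw [hsub] at hlift
  have hmem : (α, pev T2 q) ∈ X1 ∪ X2 := by
    by_cases hall : ∀ p ∈ s, pev p (α, pev T2 q) = 0
    · rw [hsq _ hall]
      exact Or.inl hz1
    · push Not at hall
      obtain ⟨p, hp, hpq⟩ := hall
      have := hlift.kallin hX1c hX2c ⟨_, hz1⟩ ⟨_, hz2⟩ p hc (by
        rintro _ ⟨x, hx, rfl⟩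
        exact hs1 p hp x (hDsub hx)) (by
        rintro _ ⟨x, hx, rfl⟩
        exact hs2 p hp x (hDsub hx)) (by
        rintro _ (⟨x, hx, rfl⟩ | ⟨x, hx, rfl⟩) h0
        · obtain rfl := hs0 p hp x (hDsub hx) (Or.inl h0)
          simp only [ha0, hb0]
          exact ⟨hz1, hz2⟩
        · obtain rfl := hs0 p hp x (hDsub hx) (Or.inr h0)
          simp only [ha0, hb0, neg_zero]
          exact ⟨hz1, hz2⟩) hpq
      rcases this with h' | h'
      · exact Or.inl (sheet h')
      · exact Or.inr (sheet2 h')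
  rw [← hsub] at hmem
  obtain ⟨y, hy, e⟩ := hmem
  have : y = q := hT (by simpa [hα] using e)
  exact this ▸ hy

/-- `g` is locally Lipschitz on the unit ball with constant of order `‖x‖ ^ k`. -/
def OrdLip {E G : Type*} [NormedAddCommGroup E] [NormedAddCommGroup G] (k : ℕ) (g : E → G) : Prop :=
  g 0 = 0 ∧ ∃ C : ℝ, 0 ≤ C ∧ ∀ x y : E, ‖x‖ ≤ 1 → ‖y‖ ≤ 1 →
    ‖g x - g y‖ ≤ C * max ‖x‖ ‖y‖ ^ k * ‖x - y‖

lemma OrdLip.norm_le {E G : Type*} [NormedAddCommGroup E] [NormedAddCommGroup G] {k : ℕ} {g : E → G}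
    (h : OrdLip k g) : ∃ C : ℝ, 0 ≤ C ∧ ∀ x : E, ‖x‖ ≤ 1 → ‖g x‖ ≤ C * ‖x‖ ^ (k + 1) := by
  obtain ⟨h0, C, hC, hg⟩ := h
  refine ⟨C, hC, fun x hx => ?_⟩
  have := hg x 0 hx (by simp)
  rw [h0, sub_zero, sub_zero, norm_zero, max_eq_left (norm_nonneg _)] at this
  rw [pow_succ, ← mul_assoc]
  exact this

lemma norm_le_mul_norm_linear {k : ℂ} (hk : k.im ≠ 0) : ∃ C : ℝ, 0 < C ∧ ∀ x : ℝ × ℝ,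
    ‖x‖ ≤ C * ‖(x.1 + k * x.2 : ℂ)‖ := by
  refine ⟨1 + (1 + ‖k‖) / |k.im|, by positivity, fun x => ?_⟩
  have hk' : 0 < |k.im| := abs_pos.2 hk
  set w : ℂ := x.1 + k * x.2 with hw
  have h1 : |x.2| ≤ ‖w‖ / |k.im| := by
    rw [le_div_iff₀ hk']
    have : w.im = k.im * x.2 := by simp [hw]
    rw [mul_comm, ← abs_mul, ← this]
    exact Complex.abs_im_le_norm _
  have h2 : |x.1| ≤ ‖w‖ + ‖k‖ * |x.2| := by
    have : (x.1 : ℂ) = w - k * x.2 := by rw [hw]; ring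
    have h3 := norm_sub_le w (k * x.2)
    rw [← this, norm_mul, Complex.norm_real, Complex.norm_real] at h3
    exact h3
  have h4 : ‖k‖ * |x.2| ≤ ‖k‖ * (‖w‖ / |k.im|) := by gcongr
  have e : (1 + (1 + ‖k‖) / |k.im|) * ‖w‖ = ‖w‖ + ‖w‖ / |k.im| + ‖k‖ * (‖w‖ / |k.im|) := by
    field_simp
    ring
  have p1 : 0 ≤ ‖k‖ * (‖w‖ / |k.im|) := by positivity
  have p2 : 0 ≤ ‖w‖ / |k.im| := by positivity
  rw [e, Prod.norm_def, Real.norm_eq_abs, Real.norm_eq_abs]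
  exact max_le (by linarith) (by linarith [norm_nonneg w])

lemma exists_sqrt_near_one (z : ℂ) : ∃ w : ℂ, w ^ 2 = z ∧ ‖w - 1‖ ≤ ‖z - 1‖ := by
  obtain ⟨v, hv⟩ := IsAlgClosed.exists_pow_nat_eq z (n := 2) (by norm_num)
  obtain ⟨w, hw, hre⟩ : ∃ w : ℂ, w ^ 2 = z ∧ 0 ≤ w.re := by
    rcases le_total 0 v.re with h | h
    · exact ⟨v, hv, h⟩
    · exact ⟨-v, by rw [neg_sq, hv], by simpa using h⟩
  refine ⟨w, hw, ?_⟩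
  have h1 : z - 1 = (w - 1) * (w + 1) := by rw [← hw]; ring
  have h2 : 1 ≤ ‖w + 1‖ := by
    refine le_trans ?_ (Complex.re_le_norm _)
    simpa using hre
  rw [h1, norm_mul]
  exact le_mul_of_one_le_right (norm_nonneg _) h2

/-- A square root of `Y = L ^ 2 + R` close to the linear form `L`. -/
lemma exists_sqrt_near_linear {Y : ℝ × ℝ → ℂ} {k : ℂ} (hk : k.im ≠ 0)
    (hR : OrdLip 2 fun x : ℝ × ℝ => Y x - (x.1 + k * x.2) ^ 2) :
    ∃ a : ℝ × ℝ → ℂ, (∀ x, a x ^ 2 = Y x) ∧ ∃ C : ℝ, 0 ≤ C ∧ ∀ x : ℝ × ℝ, ‖x‖ ≤ 1 →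
      ‖a x - (x.1 + k * x.2)‖ ≤ C * ‖x‖ ^ 2 := by
  obtain ⟨C0, hC0, hL⟩ := norm_le_mul_norm_linear hk
  obtain ⟨C, hC, hRC⟩ := hR.norm_le
  have : ∀ x : ℝ × ℝ, ∃ z : ℂ, z ^ 2 = Y x ∧ (‖x‖ ≤ 1 → ‖z - (x.1 + k * x.2)‖ ≤
      C * C0 * ‖x‖ ^ 2) := by
    intro x
    by_cases hx0 : x = 0
    · subst hx0
      have : Y 0 = 0 := by simpa using hR.1
      exact ⟨0, by simp [this], by simp⟩
    · have hxpos : 0 < ‖x‖ := norm_pos_iff.2 hx0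
      set l : ℂ := x.1 + k * x.2 with hl
      have hlx := hL x
      have hl0 : l ≠ 0 := by
        intro h0
        rw [← hl, h0, norm_zero, mul_zero] at hlx
        linarith
      have hlpos : 0 < ‖l‖ := norm_pos_iff.2 hl0
      obtain ⟨w, hw, hw1⟩ := exists_sqrt_near_one (Y x / l ^ 2)
      refine ⟨l * w, by rw [mul_pow, hw]; field_simp, fun hx => ?_⟩
      have e1 : Y x / l ^ 2 - 1 = (Y x - l ^ 2) / l ^ 2 := by field_simp
      rw [e1, norm_div, norm_pow] at hw1
      have e2 : l * w - l = l * (w - 1) := by ring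
      rw [e2, norm_mul]
      have hRx : ‖Y x - l ^ 2‖ ≤ C * ‖x‖ ^ 3 := hRC x hx
      calc ‖l‖ * ‖w - 1‖ ≤ ‖l‖ * (‖Y x - l ^ 2‖ / ‖l‖ ^ 2) := by gcongr
        _ = ‖Y x - l ^ 2‖ / ‖l‖ := by field_simp
        _ ≤ C * C0 * ‖x‖ ^ 2 := by
          rw [div_le_iff₀ hlpos]
          calc ‖Y x - l ^ 2‖ ≤ C * ‖x‖ ^ 2 * ‖x‖ := by rw [mul_assoc, ← pow_succ]; exact hRx
            _ ≤ C * ‖x‖ ^ 2 * (C0 * ‖l‖) := by gcongr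
            _ = _ := by ring
  choose a ha using this
  exact ⟨a, fun x => (ha x).1, C * C0, by positivity, fun x hx => (ha x).2 hx⟩

lemma norm_linear_le (k : ℂ) (x : ℝ × ℝ) : ‖(x.1 + k * x.2 : ℂ)‖ ≤ (1 + ‖k‖) * ‖x‖ := by
  refine (norm_add_le _ _).trans ?_
  rw [norm_mul, Complex.norm_real, Complex.norm_real, add_mul, one_mul]
  gcongr
  · exact norm_fst_le x
  · exact norm_snd_le x

/-- The square root close to the linear form is Lipschitz-close to it. -/
lemma sqrt_sub_linear_lipschitz {Y a : ℝ × ℝ → ℂ} {k : ℂ} (hk : k.im ≠ 0)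
    (hR : OrdLip 2 fun x : ℝ × ℝ => Y x - (x.1 + k * x.2) ^ 2) (ha : ∀ x, a x ^ 2 = Y x)
    {C1 : ℝ} (hC1 : 0 ≤ C1)
    (haC : ∀ x : ℝ × ℝ, ‖x‖ ≤ 1 → ‖a x - (x.1 + k * x.2)‖ ≤ C1 * ‖x‖ ^ 2) :
    ∃ δ > 0, ∃ C : ℝ, 0 ≤ C ∧ ∀ x y : ℝ × ℝ, ‖x‖ ≤ δ → ‖y‖ ≤ δ →
      ‖(a x - (x.1 + k * x.2)) - (a y - (y.1 + k * y.2))‖ ≤ C * max ‖x‖ ‖y‖ * ‖x - y‖ := by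
  obtain ⟨C0, hC0, hL⟩ := norm_le_mul_norm_linear hk
  obtain ⟨-, C, hC, hRC⟩ := hR
  refine ⟨min 1 (1 / (4 * C0 * (C1 + 1))), by positivity,
    2 * C0 * (C + 2 * C1 * (1 + ‖k‖)) + 2 * C1, by positivity, fun x y hx hy => ?_⟩
  have hx1 : ‖x‖ ≤ 1 := hx.trans (min_le_left _ _)
  have hy1 : ‖y‖ ≤ 1 := hy.trans (min_le_left _ _)
  set M := max ‖x‖ ‖y‖ with hM
  have hMδ : M ≤ 1 / (4 * C0 * (C1 + 1)) :=
    max_le (hx.trans (min_le_right _ _)) (hy.trans (min_le_right _ _))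
  have hxM : ‖x‖ ≤ M := le_max_left _ _
  have hyM : ‖y‖ ≤ M := le_max_right _ _
  have hM0 : 0 ≤ M := (norm_nonneg x).trans hxM
  set e1 := a x - (x.1 + k * x.2) with he1
  set e2 := a y - (y.1 + k * y.2) with he2
  have he1M : ‖e1‖ ≤ C1 * M ^ 2 := (haC x hx1).trans (by gcongr)
  have he2M : ‖e2‖ ≤ C1 * M ^ 2 := (haC y hy1).trans (by gcongr)
  have hRxy : ‖(Y x - (x.1 + k * x.2) ^ 2) - (Y y - (y.1 + k * y.2) ^ 2)‖ ≤
    C * M ^ 2 * ‖x - y‖ := hRC x y hx1 hy1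
  have hd0 := norm_nonneg (x - y)
  have hA : 0 ≤ 2 * C0 * (C + 2 * C1 * (1 + ‖k‖)) * M * ‖x - y‖ := by positivity
  have hB : 0 ≤ 2 * C1 * M * ‖x - y‖ := by positivity
  by_cases hcase : M ≤ ‖x + y‖
  · rcases hM0.eq_or_lt with h0 | hMpos
    · rw [← h0] at he1M he2M
      have := norm_sub_le e1 e2
      rw [← h0]
      norm_num at he1M he2M ⊢
      rw [he1M, he2M, sub_zero]
    · have hsum : M / (2 * C0) ≤ ‖a x + a y‖ := by
        have h1 : ‖x + y‖ ≤ C0 * ‖(((x + y).1 : ℝ) + k * ((x + y).2 : ℝ) : ℂ)‖ := hL (x + y)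
        have h2 : (((x + y).1 : ℝ) + k * ((x + y).2 : ℝ) : ℂ) = (a x + a y) - (e1 + e2) := by
          rw [he1, he2, Prod.fst_add, Prod.snd_add]
          push_cast
          ring
        rw [h2] at h1
        have h3 := norm_sub_le (a x + a y) (e1 + e2)
        have h4 := norm_add_le e1 e2
        have h5 : ‖(a x + a y) - (e1 + e2)‖ ≤ ‖a x + a y‖ + 2 * C1 * M ^ 2 := by linarith
        have h6 : M ≤ C0 * (‖a x + a y‖ + 2 * C1 * M ^ 2) :=
          hcase.trans (h1.trans (by gcongr))
        have h7 : C0 * (2 * C1 * M ^ 2) ≤ M / 2 := by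
          rw [le_div_iff₀ (by positivity)] at hMδ
          nlinarith [mul_nonneg hM0 hC0.le]
        rw [div_le_iff₀ (by positivity)]
        nlinarith
      have hid : (e1 - e2) * (a x + a y) =
          ((Y x - (x.1 + k * x.2) ^ 2) - (Y y - (y.1 + k * y.2) ^ 2)) -
          (((x - y).1 : ℝ) + k * ((x - y).2 : ℝ)) * (e1 + e2) := by
        rw [← ha, ← ha, he1, he2, Prod.fst_sub, Prod.snd_sub]
        push_cast
        ring
      have hn : ‖e1 - e2‖ * ‖a x + a y‖ ≤ (C + 2 * C1 * (1 + ‖k‖)) * M ^ 2 * ‖x - y‖ := by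
        rw [← norm_mul, hid]
        refine (norm_sub_le _ _).trans ?_
        rw [norm_mul]
        have h4 := norm_add_le e1 e2
        have h5 : ‖e1 + e2‖ ≤ 2 * C1 * M ^ 2 := by linarith
        have h6 := norm_linear_le k (x - y)
        calc _ ≤ C * M ^ 2 * ‖x - y‖ + (1 + ‖k‖) * ‖x - y‖ * (2 * C1 * M ^ 2) := by gcongr
          _ = _ := by ring
      have h8 : ‖e1 - e2‖ * (M / (2 * C0)) ≤ (C + 2 * C1 * (1 + ‖k‖)) * M ^ 2 * ‖x - y‖ :=
        le_trans (by gcongr) hn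
      have h9 : ‖e1 - e2‖ ≤ 2 * C0 * (C + 2 * C1 * (1 + ‖k‖)) * M * ‖x - y‖ := by
        rw [mul_div_assoc', div_le_iff₀ (by positivity)] at h8
        refine le_of_mul_le_mul_right ?_ hMpos
        calc _ ≤ _ := h8
          _ = _ := by ring
      linarith
  · push Not at hcase
    have hxy : M ≤ ‖x - y‖ := by
      rcases max_choice ‖x‖ ‖y‖ with h | h
      · have h1 := norm_add_le (x + y) (x - y)
        have h2 : ‖(x + y) + (x - y)‖ = 2 * ‖x‖ := by
          rw [show (x + y) + (x - y) = (2 : ℝ) • x by rw [two_smul]; abel, norm_smul]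
          norm_num
        rw [h2, ← h, ← hM] at h1
        linarith
      · have h1 := norm_sub_le (x + y) (x - y)
        have h2 : ‖(x + y) - (x - y)‖ = 2 * ‖y‖ := by
          rw [show (x + y) - (x - y) = (2 : ℝ) • y by rw [two_smul]; abel, norm_smul]
          norm_num
        rw [h2, ← h, ← hM] at h1
        linarith
    have h1 : ‖e1 - e2‖ ≤ 2 * C1 * M * M := by
      refine (norm_sub_le _ _).trans ?_
      calc _ ≤ C1 * M ^ 2 + C1 * M ^ 2 := by gcongr
        _ = _ := by ring
    have h2 : 2 * C1 * M * M ≤ 2 * C1 * M * ‖x - y‖ := by gcongr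
    linarith

section

open Asymptotics Filter Topology

/-- The weight `|s| + t ^ 2` adapted to the umbrella. -/
def wt (x : ℝ × ℝ) : ℝ := |x.2| + x.1 ^ 2

lemma wt_nonneg (x : ℝ × ℝ) : 0 ≤ wt x := by unfold wt; positivity

lemma wt_eq_zero {x : ℝ × ℝ} (h : wt x = 0) : x = 0 := by
  unfold wt at h
  have h1 : |x.2| = 0 := by nlinarith [abs_nonneg x.2, sq_nonneg x.1]
  have h2 : x.1 ^ 2 = 0 := by nlinarith [abs_nonneg x.2, sq_nonneg x.1]
  exact Prod.ext (by simpa using h2) (by simpa using h1)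

lemma norm_isBigO_one : (fun x : ℝ × ℝ => ‖x‖) =O[nhds 0] (fun _ => (1 : ℝ)) :=
  (continuous_norm.tendsto _).isBigO_one ℝ

lemma fst_isBigO : (fun x : ℝ × ℝ => x.1) =O[nhds 0] (fun x => ‖x‖) :=
  IsBigO.of_bound 1 (Eventually.of_forall fun x => by simpa using norm_fst_le x)

lemma snd_isBigO_wt : (fun x : ℝ × ℝ => x.2) =O[nhds 0] wt :=
  IsBigO.of_bound 1 (Eventually.of_forall fun x => by
    rw [one_mul, Real.norm_of_nonneg (wt_nonneg x), Real.norm_eq_abs, wt]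
    linarith [sq_nonneg x.1])

lemma fst_sq_isBigO_wt : (fun x : ℝ × ℝ => x.1 ^ 2) =O[nhds 0] wt :=
  IsBigO.of_bound 1 (Eventually.of_forall fun x => by
    rw [one_mul, Real.norm_of_nonneg (wt_nonneg x), Real.norm_of_nonneg (sq_nonneg _), wt]
    linarith [abs_nonneg x.2])

lemma wt_isBigO_norm : wt =O[nhds 0] (fun x : ℝ × ℝ => ‖x‖) := by
  have h1 : (fun x : ℝ × ℝ => |x.2|) =O[nhds 0] (fun x => ‖x‖) :=
    IsBigO.of_bound 1 (Eventually.of_forall fun x => by simpa using norm_snd_le x)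
  have h2 : (fun x : ℝ × ℝ => x.1 ^ 2) =O[nhds 0] (fun x => ‖x‖) := by
    simpa [sq] using fst_isBigO.mul (fst_isBigO.trans norm_isBigO_one)
  exact h1.add h2

lemma mul_one_isBigO {f g h : ℝ × ℝ → ℝ} (hf : f =O[nhds 0] h)
    (hg : g =O[nhds 0] fun _ => (1 : ℝ)) : (fun x => f x * g x) =O[nhds 0] h := by
  simpa using hf.mul hg

lemma wt_isBigO_one : wt =O[nhds 0] (fun _ => (1 : ℝ)) := wt_isBigO_norm.trans norm_isBigO_one

/-- Weighted expansion of the coordinates of one sheet. -/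
structure SheetExpansion (A B U V : ℝ × ℝ → ℝ) (m α β κ : ℝ) : Prop where
  hA : (fun x => A x - x.1) =O[nhds 0] wt
  hB : (fun x => B x - (-(m / 2) * x.2 + α * x.1 ^ 2)) =O[nhds 0] fun x => ‖x‖ * wt x
  hU : (fun x => U x - (x.2 + β * x.1 ^ 2)) =O[nhds 0] fun x => ‖x‖ * wt x
  hV : (fun x => V x + κ * x.1 ^ 3) =O[nhds 0] fun x => wt x ^ 2

namespace SheetExpansion

variable {A B U V : ℝ × ℝ → ℝ} {m α β κ : ℝ}

lemma norm_mul_wt : (fun x : ℝ × ℝ => ‖x‖ * wt x) =O[nhds 0] wt := by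
  simpa using norm_isBigO_one.mul (isBigO_refl wt (nhds 0))

lemma lin_wt (c d : ℝ) : (fun x : ℝ × ℝ => c * x.2 + d * x.1 ^ 2) =O[nhds 0] wt :=
  (snd_isBigO_wt.const_mul_left c).add (fst_sq_isBigO_wt.const_mul_left d)

lemma B_wt (h : SheetExpansion A B U V m α β κ) : B =O[nhds 0] wt := by
  refine ((h.hB.trans norm_mul_wt).add (lin_wt (-(m / 2)) α)).congr_left fun x => ?_
  ring

lemma U_wt (h : SheetExpansion A B U V m α β κ) : U =O[nhds 0] wt := by
  refine ((h.hU.trans norm_mul_wt).add (lin_wt 1 β)).congr_left fun x => ?_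
  ring

lemma A_norm (h : SheetExpansion A B U V m α β κ) : A =O[nhds 0] fun x => ‖x‖ := by
  refine ((h.hA.trans wt_isBigO_norm).add fst_isBigO).congr_left fun x => ?_
  ring

lemma V_norm_mul_wt (h : SheetExpansion A B U V m α β κ) :
    V =O[nhds 0] fun x => ‖x‖ * wt x := by
  have h1 : (fun x : ℝ × ℝ => wt x ^ 2) =O[nhds 0] fun x => ‖x‖ * wt x := by
    simpa [sq] using wt_isBigO_norm.mul (isBigO_refl wt (nhds 0))
  have h2 : (fun x : ℝ × ℝ => κ * x.1 ^ 3) =O[nhds 0] fun x => ‖x‖ * wt x := by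
    refine ((fst_isBigO.mul fst_sq_isBigO_wt).const_mul_left κ).congr_left fun x => ?_
    ring
  refine ((h.hV.trans h1).sub h2).congr_left fun x => ?_
  ring

lemma A_sq_sub (h : SheetExpansion A B U V m α β κ) :
    (fun x => A x ^ 2 - x.1 ^ 2) =O[nhds 0] fun x => ‖x‖ * wt x := by
  refine ((h.A_norm.add fst_isBigO).mul h.hA).congr_left fun x => ?_
  ring

lemma A_sq_wt (h : SheetExpansion A B U V m α β κ) : (fun x => A x ^ 2) =O[nhds 0] wt := by
  refine ((h.A_sq_sub.trans norm_mul_wt).add fst_sq_isBigO_wt).congr_left fun x => ?_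
  ring

/-- Leading part of the imaginary part of the Kallin polynomial. -/
lemma im_expansion (h : SheetExpansion A B U V m α β κ) (hm : 0 < m) {ν : ℝ}
    (hν : β + 3 * ν = -(2 * α / m)) (c1 c2 : ℝ) :
    (fun x => (A x * V x + B x * U x + ν * (3 * A x ^ 2 * B x - B x ^ 3) + c1 * (2 * U x * V x) +
      c2 * (4 * A x ^ 3 * B x - 4 * A x * B x ^ 3)) +
      (m / 2 * (x.2 - 2 * α / m * x.1 ^ 2) ^ 2 + κ * x.1 ^ 4)) =O[nhds 0]
      fun x => ‖x‖ * wt x ^ 2 := by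
  have t1 : (fun x => (A x - x.1) * V x) =O[nhds 0] fun x => ‖x‖ * wt x ^ 2 :=
    (h.hA.mul h.V_norm_mul_wt).congr_right fun x => by ring
  have t2 : (fun x => x.1 * (V x + κ * x.1 ^ 3)) =O[nhds 0] fun x => ‖x‖ * wt x ^ 2 :=
    fst_isBigO.mul h.hV
  have t3 : (fun x => (B x - (-(m / 2) * x.2 + α * x.1 ^ 2)) * U x) =O[nhds 0]
      fun x => ‖x‖ * wt x ^ 2 := (h.hB.mul h.U_wt).congr_right fun x => by ring
  have t4 : (fun x => (-(m / 2) * x.2 + α * x.1 ^ 2) * (U x - (x.2 + β * x.1 ^ 2))) =O[nhds 0]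
      fun x => ‖x‖ * wt x ^ 2 :=
    ((lin_wt (-(m / 2)) α).mul h.hU).congr_right fun x => by ring
  have t5 : (fun x => (A x ^ 2 - x.1 ^ 2) * B x) =O[nhds 0] fun x => ‖x‖ * wt x ^ 2 :=
    (h.A_sq_sub.mul h.B_wt).congr_right fun x => by ring
  have t6 : (fun x => x.1 ^ 2 * (B x - (-(m / 2) * x.2 + α * x.1 ^ 2))) =O[nhds 0]
      fun x => ‖x‖ * wt x ^ 2 :=
    (fst_sq_isBigO_wt.mul h.hB).congr_right fun x => by ring
  have t7 : (fun x => B x ^ 3) =O[nhds 0] fun x => ‖x‖ * wt x ^ 2 :=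
    ((h.B_wt.trans wt_isBigO_norm).mul (h.B_wt.pow 2)).congr_left fun x => by ring
  have t8 : (fun x => U x * V x) =O[nhds 0] fun x => ‖x‖ * wt x ^ 2 :=
    (h.U_wt.mul h.V_norm_mul_wt).congr_right fun x => by ring
  have t9 : (fun x => A x * A x ^ 2 * B x) =O[nhds 0] fun x => ‖x‖ * wt x ^ 2 :=
    ((h.A_norm.mul h.A_sq_wt).mul h.B_wt).congr_right fun x => by ring
  have t10 : (fun x => A x * B x ^ 2 * B x) =O[nhds 0] fun x => ‖x‖ * wt x ^ 2 :=
    mul_one_isBigO (h.A_norm.mul (h.B_wt.pow 2)) (h.B_wt.trans wt_isBigO_one)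
  have := (((((t1.add t2).add (t3.add t4)).add
    ((t5.add t6).const_mul_left (3 * ν))).sub (t7.const_mul_left ν)).add
    (t8.const_mul_left (2 * c1))).add ((t9.sub t10).const_mul_left (4 * c2))
  refine this.congr_left fun x => ?_
  have hβ : β = -(2 * α / m) - 3 * ν := by linarith
  subst hβ
  field_simp
  ring

lemma eventually_le (h : SheetExpansion A B U V m α β κ) (hm : 0 < m) (hκ : 0 < κ) {ν : ℝ}
    (hν : β + 3 * ν = -(2 * α / m)) (c1 c2 : ℝ) :
    ∃ c > 0, ∀ᶠ x in nhds 0, A x * V x + B x * U x + ν * (3 * A x ^ 2 * B x - B x ^ 3) +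
      c1 * (2 * U x * V x) + c2 * (4 * A x ^ 3 * B x - 4 * A x * B x ^ 3) ≤ -(c * wt x ^ 2) := by
  set γ := 2 * α / m with hγ
  obtain ⟨c0, hc0, hmain⟩ : ∃ c > 0, ∀ x : ℝ × ℝ,
      c * wt x ^ 2 ≤ m / 2 * (x.2 - γ * x.1 ^ 2) ^ 2 + κ * x.1 ^ 4 := by
    refine ⟨min (m / 4) (κ / (2 * (1 + |γ|) ^ 2)), by positivity, fun x => ?_⟩
    have h1 : wt x ≤ |x.2 - γ * x.1 ^ 2| + (1 + |γ|) * x.1 ^ 2 := by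
      have h2 := abs_sub_abs_le_abs_sub x.2 (γ * x.1 ^ 2)
      rw [abs_mul, abs_of_nonneg (sq_nonneg x.1)] at h2
      unfold wt
      linarith
    have h3 : wt x ^ 2 ≤ 2 * (x.2 - γ * x.1 ^ 2) ^ 2 + 2 * (1 + |γ|) ^ 2 * x.1 ^ 4 := by
      have h4 := pow_le_pow_left₀ (wt_nonneg x) h1 2
      rw [← sq_abs (x.2 - γ * x.1 ^ 2)]
      nlinarith [sq_nonneg (|x.2 - γ * x.1 ^ 2| - (1 + |γ|) * x.1 ^ 2)]
    have h5 : min (m / 4) (κ / (2 * (1 + |γ|) ^ 2)) * (2 * (x.2 - γ * x.1 ^ 2) ^ 2) ≤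
        m / 4 * (2 * (x.2 - γ * x.1 ^ 2) ^ 2) := by
      gcongr
      exact min_le_left _ _
    have h6 : min (m / 4) (κ / (2 * (1 + |γ|) ^ 2)) * (2 * (1 + |γ|) ^ 2 * x.1 ^ 4) ≤
        κ / (2 * (1 + |γ|) ^ 2) * (2 * (1 + |γ|) ^ 2 * x.1 ^ 4) := by
      have : (0 : ℝ) ≤ x.1 ^ 4 := by positivity
      gcongr
      exact min_le_right _ _
    have h7 : κ / (2 * (1 + |γ|) ^ 2) * (2 * (1 + |γ|) ^ 2 * x.1 ^ 4) = κ * x.1 ^ 4 := by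
      have : (1 + |γ|) ≠ 0 := by positivity
      field_simp
    have h8 : 0 < min (m / 4) (κ / (2 * (1 + |γ|) ^ 2)) := by positivity
    nlinarith [mul_le_mul_of_nonneg_left h3 h8.le]
  refine ⟨c0 / 2, by positivity, ?_⟩
  have hO := h.im_expansion hm hν c1 c2
  have ho : (fun x : ℝ × ℝ => ‖x‖ * wt x ^ 2) =o[nhds 0] fun x => wt x ^ 2 := by
    have : (fun x : ℝ × ℝ => ‖x‖) =o[nhds 0] (fun _ => (1 : ℝ)) := by
      rw [isLittleO_one_iff]
      simpa using (continuous_norm (E := ℝ × ℝ)).tendsto 0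
    simpa using this.mul_isBigO (isBigO_refl (fun x : ℝ × ℝ => wt x ^ 2) (nhds 0))
  filter_upwards [(hO.trans_isLittleO ho).bound (half_pos hc0)] with x hx
  rw [Real.norm_of_nonneg (sq_nonneg (wt x)), Real.norm_eq_abs] at hx
  have := (le_abs_self _).trans hx
  linarith [hmain x]

end SheetExpansion

/-- The polynomials to which Kallin's lemma is applied. -/
def kallinPoly (ν c1 c2 : ℝ) : MvPolynomial (Fin 2) ℂ :=
  MvPolynomial.X 0 * MvPolynomial.X 1 + MvPolynomial.C (ν : ℂ) * MvPolynomial.X 0 ^ 3 +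
    MvPolynomial.C (c1 : ℂ) * MvPolynomial.X 1 ^ 2 + MvPolynomial.C (c2 : ℂ) * MvPolynomial.X 0 ^ 4

lemma pev_kallinPoly (ν c1 c2 : ℝ) (q : ℂ × ℂ) :
    pev (kallinPoly ν c1 c2) q = q.1 * q.2 + ν * q.1 ^ 3 + c1 * q.2 ^ 2 + c2 * q.1 ^ 4 := by
  simp [kallinPoly]

lemma pev_kallinPoly_neg (ν c1 c2 : ℝ) (a b : ℂ) :
    pev (kallinPoly ν c1 c2) (-a, b) = -pev (kallinPoly ν (-c1) (-c2)) (a, b) := by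
  simp only [pev_kallinPoly]
  push_cast
  ring

lemma im_pev_kallinPoly (ν c1 c2 : ℝ) (a b : ℂ) :
    (pev (kallinPoly ν c1 c2) (a, b)).im = a.re * b.im + a.im * b.re +
      ν * (3 * a.re ^ 2 * a.im - a.im ^ 3) + c1 * (2 * b.re * b.im) +
      c2 * (4 * a.re ^ 3 * a.im - 4 * a.re * a.im ^ 3) := by
  rw [pev_kallinPoly]
  simp only [Complex.add_im, Complex.mul_im, Complex.mul_re, pow_succ, pow_zero, one_mul,
    Complex.ofReal_re, Complex.ofReal_im]
  ring

lemma SheetExpansion.kallin {a b : ℝ × ℝ → ℂ} {m α β κ : ℝ}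
    (h : SheetExpansion (fun x => (a x).re) (fun x => (a x).im) (fun x => (b x).re)
      (fun x => (b x).im) m α β κ) (hm : 0 < m) (hκ : 0 < κ) {ν : ℝ}
    (hν : β + 3 * ν = -(2 * α / m)) (c1 c2 : ℝ) :
    ∃ c > 0, ∀ᶠ x in nhds 0,
      c * ‖pev (kallinPoly ν c1 c2) (a x, b x)‖ ^ 2 ≤ -(pev (kallinPoly ν c1 c2) (a x, b x)).im ∧
      (pev (kallinPoly ν c1 c2) (a x, b x) = 0 → x = 0) := by
  obtain ⟨c, hc, hev⟩ := h.eventually_le hm hκ hν c1 c2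
  have hV : (fun x => (b x).im) =O[nhds 0] wt := h.V_norm_mul_wt.trans SheetExpansion.norm_mul_wt
  have hb : b =O[nhds 0] wt := by
    refine ((Complex.isBigO_ofReal_left.2 h.U_wt).add
      ((Complex.isBigO_ofReal_left.2 hV).const_mul_left Complex.I)).congr_left fun x => ?_
    rw [mul_comm]
    exact Complex.re_add_im _
  have ha : a =O[nhds 0] fun x => ‖x‖ := by
    refine ((Complex.isBigO_ofReal_left.2 h.A_norm).add
      ((Complex.isBigO_ofReal_left.2 (h.B_wt.trans wt_isBigO_norm)).const_mul_left
        Complex.I)).congr_left fun x => ?_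
    rw [mul_comm]
    exact Complex.re_add_im _
  have ha1 : a =O[nhds 0] fun _ => (1 : ℝ) := ha.trans norm_isBigO_one
  have hb1 : b =O[nhds 0] fun _ => (1 : ℝ) := hb.trans wt_isBigO_one
  have ha2 : (fun x => a x ^ 2) =O[nhds 0] wt := by
    have hB2 : (fun x => (a x).im ^ 2) =O[nhds 0] wt := by
      simpa [sq] using mul_one_isBigO h.B_wt (h.B_wt.trans wt_isBigO_one)
    rw [← isBigO_norm_left]
    refine (h.A_sq_wt.add hB2).congr_left fun x => ?_
    rw [norm_pow, Complex.sq_norm, Complex.normSq_apply]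
    ring
  have hp : (fun x => pev (kallinPoly ν c1 c2) (a x, b x)) =O[nhds 0] wt := by
    have s1 : (fun x => a x * b x) =O[nhds 0] wt := by simpa using ha1.mul hb
    have s2 : (fun x => a x * a x ^ 2) =O[nhds 0] wt := by simpa using ha1.mul ha2
    have s3 : (fun x => b x * b x) =O[nhds 0] wt := by simpa using hb1.mul hb
    have s4 : (fun x => a x * (a x * a x ^ 2)) =O[nhds 0] wt := by simpa using ha1.mul s2
    refine (((s1.add (s2.const_mul_left (ν : ℂ))).add (s3.const_mul_left (c1 : ℂ))).add
      (s4.const_mul_left (c2 : ℂ))).congr_left fun x => ?_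
    rw [pev_kallinPoly]
    ring
  obtain ⟨C, hC, hpC⟩ := hp.exists_pos
  refine ⟨c / C ^ 2, by positivity, ?_⟩
  filter_upwards [hpC.bound, hev] with x h1 h2
  rw [← im_pev_kallinPoly] at h2
  rw [Real.norm_of_nonneg (wt_nonneg x)] at h1
  constructor
  · have h3 := pow_le_pow_left₀ (norm_nonneg _) h1 2
    calc _ ≤ c / C ^ 2 * (C * wt x) ^ 2 := by gcongr
      _ = c * wt x ^ 2 := by field_simp
      _ ≤ _ := by linarith
  · intro h0
    rw [h0, Complex.zero_im] at h2
    refine wt_eq_zero ?_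
    have : wt x ^ 2 ≤ 0 := by
      by_contra! h4
      nlinarith
    exact pow_eq_zero_iff two_ne_zero |>.1 (le_antisymm this (sq_nonneg _))

end

section

open Asymptotics Filter Topology

/-- Normal form of an umbrella: the pair `(Y, b)` parametrizes it, and `Y` is close to the square
of the linear form `t + k s`. -/
structure UmbrellaForm (Y b : ℝ × ℝ → ℂ) (k α : ℂ) (β κ m : ℝ) : Prop where
  m_pos : 0 < m
  κ_pos : 0 < κ
  k_im : k.im = -(m / 2)
  quad : OrdLip 2 fun x : ℝ × ℝ => Y x - (x.1 + k * x.2) ^ 2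
  cubic : (fun t : ℝ => Y (t, 0) - t ^ 2 - 2 * α * t ^ 3) =O[nhds 0] fun t : ℝ => t ^ 4
  lin : OrdLip 1 fun x : ℝ × ℝ => b x - x.2
  b_re : (fun x => (b x).re - (x.2 + β * x.1 ^ 2)) =O[nhds 0] fun x => ‖x‖ * wt x
  b_im : (fun x => (b x).im + κ * x.1 ^ 3) =O[nhds 0] fun x => wt x ^ 2

namespace UmbrellaForm

variable {Y b : ℝ × ℝ → ℂ} {k α : ℂ} {β κ m : ℝ}

lemma sqrt_expansion_axis (h : UmbrellaForm Y b k α β κ m) {a : ℝ × ℝ → ℂ}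
    (ha : ∀ x, a x ^ 2 = Y x) {C1 : ℝ}
    (haC : ∀ x : ℝ × ℝ, ‖x‖ ≤ 1 → ‖a x - (x.1 + k * x.2)‖ ≤ C1 * ‖x‖ ^ 2) :
    (fun t : ℝ => a (t, 0) - t - α * t ^ 2) =O[nhds 0] fun t : ℝ => t ^ 3 := by
  obtain ⟨C, hC, hY⟩ := h.cubic.exists_pos
  refine IsBigO.of_bound (C + C1 ^ 2) ?_
  filter_upwards [hY.bound, closedBall_mem_nhds (0 : ℝ) one_pos] with t ht ht1
  rw [mem_closedBall_zero_iff] at ht1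
  have hn : ‖((t, 0) : ℝ × ℝ)‖ = |t| := by simp [Prod.norm_def]
  have he := haC (t, 0) (by rwa [hn])
  rw [hn, sq_abs] at he
  simp only [Complex.ofReal_zero, mul_zero, add_zero] at he
  rw [norm_pow, Real.norm_eq_abs] at ht ⊢
  rcases eq_or_ne t 0 with rfl | ht0
  · simp at he ⊢
    exact he
  · have htpos : 0 < |t| := abs_pos.2 ht0
    have hid : (2 * t : ℂ) * (a (t, 0) - t - α * t ^ 2) =
        (Y (t, 0) - t ^ 2 - 2 * α * t ^ 3) - (a (t, 0) - t) ^ 2 := by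
      rw [← ha]
      ring
    have h1 : 2 * |t| * ‖a (t, 0) - t - α * t ^ 2‖ ≤ C * |t| ^ 4 + (C1 * t ^ 2) ^ 2 := by
      have h2 := norm_sub_le (Y (t, 0) - t ^ 2 - 2 * α * t ^ 3) ((a (t, 0) - t) ^ 2)
      rw [← hid, norm_mul, norm_mul, norm_pow, Complex.norm_real, Real.norm_eq_abs] at h2
      norm_num at h2
      have h3 := pow_le_pow_left₀ (norm_nonneg _) he 2
      linarith
    have h4 : 2 * |t| * ‖a (t, 0) - t - α * t ^ 2‖ ≤ 2 * |t| * ((C + C1 ^ 2) * |t| ^ 3) := by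
      refine h1.trans ?_
      rw [← sq_abs t]
      have : 0 ≤ (C + C1 ^ 2) * |t| ^ 4 := by positivity
      linarith
    exact le_of_mul_le_mul_left h4 (by positivity)

lemma sqrt_expansion (h : UmbrellaForm Y b k α β κ m) {a : ℝ × ℝ → ℂ}
    (ha : ∀ x, a x ^ 2 = Y x) {C1 : ℝ}
    (haC : ∀ x : ℝ × ℝ, ‖x‖ ≤ 1 → ‖a x - (x.1 + k * x.2)‖ ≤ C1 * ‖x‖ ^ 2)
    {δ C : ℝ} (hδ : 0 < δ) (hC : 0 ≤ C) (hlip : ∀ x y : ℝ × ℝ, ‖x‖ ≤ δ → ‖y‖ ≤ δ →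
      ‖(a x - (x.1 + k * x.2)) - (a y - (y.1 + k * y.2))‖ ≤ C * max ‖x‖ ‖y‖ * ‖x - y‖) :
    (fun x : ℝ × ℝ => a x - (x.1 + k * x.2 + α * x.1 ^ 2)) =O[nhds 0] fun x => ‖x‖ * wt x := by
  have h1 : (fun x : ℝ × ℝ => (a x - (x.1 + k * x.2)) - (a (x.1, 0) - x.1)) =O[nhds 0]
      fun x => ‖x‖ * wt x := by
    refine IsBigO.of_bound C ?_
    filter_upwards [closedBall_mem_nhds (0 : ℝ × ℝ) hδ] with x hx
    rw [mem_closedBall_zero_iff] at hx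
    have hn : ‖((x.1, 0) : ℝ × ℝ)‖ = |x.1| := by simp [Prod.norm_def]
    have hn' : |x.1| ≤ ‖x‖ := norm_fst_le x
    have hd : ‖x - (x.1, 0)‖ = |x.2| := by simp [Prod.norm_def]
    have := hlip x (x.1, 0) hx (by rw [hn]; exact hn'.trans hx)
    rw [hn, hd, max_eq_left hn'] at this
    simp only [Complex.ofReal_zero, mul_zero, add_zero] at this
    refine this.trans ?_
    rw [norm_mul, norm_norm, Real.norm_of_nonneg (wt_nonneg x), mul_assoc]
    gcongr
    unfold wt
    linarith [sq_nonneg x.1]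
  have h2 : (fun x : ℝ × ℝ => a (x.1, 0) - x.1 - α * x.1 ^ 2) =O[nhds 0]
      fun x => ‖x‖ * wt x := by
    have ht : Tendsto (fun x : ℝ × ℝ => x.1) (nhds 0) (nhds 0) := continuous_fst.tendsto _
    refine ((h.sqrt_expansion_axis ha haC).comp_tendsto ht).trans ?_
    refine (fst_isBigO.mul fst_sq_isBigO_wt).congr_left fun x => ?_
    simp only [Function.comp]
    ring
  refine (h1.add h2).congr_left fun x => ?_
  ring

lemma sheetExpansion (h : UmbrellaForm Y b k α β κ m) {a : ℝ × ℝ → ℂ}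
    (hexp : (fun x : ℝ × ℝ => a x - (x.1 + k * x.2 + α * x.1 ^ 2)) =O[nhds 0]
      fun x => ‖x‖ * wt x) :
    SheetExpansion (fun x => (a x).re) (fun x => (a x).im) (fun x => (b x).re)
      (fun x => (b x).im) m α.im β κ := by
  have him : (fun x : ℝ × ℝ => (a x).im - (-(m / 2) * x.2 + α.im * x.1 ^ 2)) =O[nhds 0]
      fun x => ‖x‖ * wt x := by
    refine (IsBigO.of_bound 1 (Eventually.of_forall fun x => ?_)).trans hexp
    rw [one_mul]
    refine le_trans (le_of_eq ?_) (Complex.abs_im_le_norm _)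
    rw [Real.norm_eq_abs]
    congr 1
    simp [h.k_im, sq]
  have hre : (fun x : ℝ × ℝ => (a x).re - (x.1 + (k.re * x.2 + α.re * x.1 ^ 2))) =O[nhds 0]
      fun x => ‖x‖ * wt x := by
    refine (IsBigO.of_bound 1 (Eventually.of_forall fun x => ?_)).trans hexp
    rw [one_mul]
    refine le_trans (le_of_eq ?_) (Complex.abs_re_le_norm _)
    rw [Real.norm_eq_abs]
    congr 1
    simp [sq]
    ring
  refine ⟨?_, him, h.b_re, h.b_im⟩
  refine ((hre.trans SheetExpansion.norm_mul_wt).add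
    (SheetExpansion.lin_wt k.re α.re)).congr_left fun x => ?_
  ring

lemma exists_nearId (h : UmbrellaForm Y b k α β κ m) {a : ℝ × ℝ → ℂ} (ha0 : a 0 = 0)
    {δ C : ℝ} (hδ : 0 < δ) (hC : 0 ≤ C) (hlip : ∀ x y : ℝ × ℝ, ‖x‖ ≤ δ → ‖y‖ ≤ δ →
      ‖(a x - (x.1 + k * x.2)) - (a y - (y.1 + k * y.2))‖ ≤ C * max ‖x‖ ‖y‖ * ‖x - y‖) :
    ∃ ρ > 0, NearId (fun x => a x - k * b x) b ρ := by
  obtain ⟨hb0, Cb, hCb, hb⟩ := h.lin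
  have hb0 : b 0 = 0 := by simpa using hb0
  set K := C + ‖k‖ * Cb + Cb with hK
  have hK0 : 0 ≤ K := by positivity
  set ρ := min (min δ 1) (1 / (4 * (K + 1))) with hρ
  have hρK : K * ρ ≤ 1 / 4 := by
    have : ρ ≤ 1 / (4 * (K + 1)) := min_le_right _ _
    rw [le_div_iff₀ (by positivity)] at this
    have : 0 ≤ ρ := by positivity
    linarith
  have hmax : ∀ {x y : ℝ × ℝ}, x ∈ closedBall 0 ρ → y ∈ closedBall 0 ρ → max ‖x‖ ‖y‖ ≤ ρ :=
    fun hx hy => max_le (mem_closedBall_zero_iff.1 hx) (mem_closedBall_zero_iff.1 hy)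
  have hρδ : ρ ≤ δ := (min_le_left _ _).trans (min_le_left _ _)
  have hρ1 : ρ ≤ 1 := (min_le_left _ _).trans (min_le_right _ _)
  have hbρ : ∀ x ∈ closedBall (0 : ℝ × ℝ) ρ, ∀ y ∈ closedBall (0 : ℝ × ℝ) ρ,
      ‖(b x - x.2) - (b y - y.2)‖ ≤ Cb * max ‖x‖ ‖y‖ * ‖x - y‖ := by
    intro x hx y hy
    have := hb x y ((mem_closedBall_zero_iff.1 hx).trans hρ1)
      ((mem_closedBall_zero_iff.1 hy).trans hρ1)
    rwa [pow_one] at this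
  have fin : ∀ {x y : ℝ × ℝ} {c v : ℝ}, x ∈ closedBall 0 ρ → y ∈ closedBall 0 ρ → c ≤ K →
      v ≤ c * max ‖x‖ ‖y‖ * ‖x - y‖ → v ≤ 1 / 4 * ‖x - y‖ := by
    intro x y c v hx hy hc hv
    refine hv.trans ?_
    gcongr
    have h0 : 0 ≤ max ‖x‖ ‖y‖ := (norm_nonneg x).trans (le_max_left _ _)
    calc c * max ‖x‖ ‖y‖ ≤ K * ρ := by gcongr; exact hmax hx hy
      _ ≤ _ := hρK
  have hkC : 0 ≤ ‖k‖ * Cb := by positivity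
  refine ⟨ρ, by positivity, by simp [ha0, hb0], hb0, fun x hx y hy => ?_, fun x hx y hy => ?_⟩
  · refine fin hx hy (c := C + ‖k‖ * Cb) (by linarith) ?_
    have h1 := hlip x y ((mem_closedBall_zero_iff.1 hx).trans hρδ)
      ((mem_closedBall_zero_iff.1 hy).trans hρδ)
    have h2 := hbρ x hx y hy
    have e : (a x - k * b x - x.1) - (a y - k * b y - y.1) =
        ((a x - (x.1 + k * x.2)) - (a y - (y.1 + k * y.2))) -
        k * ((b x - x.2) - (b y - y.2)) := by ring
    rw [e]
    refine (norm_sub_le _ _).trans ?_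
    rw [norm_mul]
    calc _ ≤ C * max ‖x‖ ‖y‖ * ‖x - y‖ + ‖k‖ * (Cb * max ‖x‖ ‖y‖ * ‖x - y‖) := by gcongr
      _ = _ := by ring
  · exact fin hx hy (c := Cb) (by linarith) (hbρ x hx y hy)

/-- Small pieces of a surface in umbrella form contain their polynomial hull. -/
theorem exists_hull_subset (h : UmbrellaForm Y b k α β κ m) {F : ℝ × ℝ → ℂ × ℂ}
    {T1 T2 : MvPolynomial (Fin 2) ℂ}
    (hT : Function.Injective fun x => (pev T1 x, pev T2 x))
    (hTF : ∀ x, (pev T1 (F x), pev T2 (F x)) = (Y x, b x)) :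
    ∃ A : ℝ × ℝ → ℂ, ∃ ρ₀ > 0, ∀ ρ, 0 < ρ → ρ ≤ ρ₀ → NearId A b ρ ∧
      ∀ q, InHull (F '' boxDomain A b ρ) q → q ∈ F '' boxDomain A b ρ := by
  have hk : k.im ≠ 0 := by
    rw [h.k_im]
    linarith [h.m_pos]
  obtain ⟨a, ha, C1, hC1, haC⟩ := exists_sqrt_near_linear hk h.quad
  obtain ⟨δ, hδ, C, hC, hlip⟩ := sqrt_sub_linear_lipschitz hk h.quad ha hC1 haC
  have ha0 : a 0 = 0 := by simpa using haC 0 (by simp)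
  obtain ⟨ρ₁, hρ₁, hnear⟩ := h.exists_nearId ha0 hδ hC hlip
  have hsheet := h.sheetExpansion (h.sqrt_expansion ha haC hδ hC hlip)
  set ν := (-(2 * α.im / m) - β) / 3 with hν
  have hν' : β + 3 * ν = -(2 * α.im / m) := by rw [hν]; ring
  have hkal := hsheet.kallin h.m_pos h.κ_pos hν'
  have hpair : ∀ c1 c2 : ℝ, ∃ c > 0, ∀ᶠ x in nhds (0 : ℝ × ℝ),
      (c * ‖pev (kallinPoly ν c1 c2) (a x, b x)‖ ^ 2 ≤
        -(pev (kallinPoly ν c1 c2) (a x, b x)).im) ∧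
      (c * ‖pev (kallinPoly ν c1 c2) (-a x, b x)‖ ^ 2 ≤
        (pev (kallinPoly ν c1 c2) (-a x, b x)).im) ∧
      (pev (kallinPoly ν c1 c2) (a x, b x) = 0 ∨
        pev (kallinPoly ν c1 c2) (-a x, b x) = 0 → x = 0) := by
    intro c1 c2
    obtain ⟨c, hc, h1⟩ := hkal c1 c2
    obtain ⟨c', hc', h2⟩ := hkal (-c1) (-c2)
    refine ⟨min c c', by positivity, ?_⟩
    filter_upwards [h1, h2] with x h1 h2
    rw [pev_kallinPoly_neg, norm_neg, Complex.neg_im, neg_eq_zero]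
    refine ⟨le_trans ?_ h1.1, le_trans ?_ h2.1, fun h0 => h0.elim h1.2 h2.2⟩
    · gcongr
      exact min_le_left _ _
    · gcongr
      exact min_le_right _ _
  obtain ⟨c0, hc0, h0⟩ := hpair 0 0
  obtain ⟨c1, hc1, h1⟩ := hpair 1 0
  obtain ⟨c2, hc2, h2⟩ := hpair 0 1
  obtain ⟨ρ₂, hρ₂, hball⟩ := Metric.nhds_basis_closedBall.eventually_iff.1 (h0.and (h1.and h2))
  refine ⟨fun x => a x - k * b x, min ρ₁ ρ₂, by positivity, fun ρ hρ hle => ?_⟩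
  have hnρ := hnear.mono (hle.trans (min_le_left _ _))
  have hcomb : ∀ p ∈ ({kallinPoly ν 0 0, kallinPoly ν 1 0, kallinPoly ν 0 1} :
      Set (MvPolynomial (Fin 2) ℂ)), ∀ x ∈ closedBall (0 : ℝ × ℝ) ρ,
      (min c0 (min c1 c2) * ‖pev p (a x, b x)‖ ^ 2 ≤ -(pev p (a x, b x)).im) ∧
      (min c0 (min c1 c2) * ‖pev p (-a x, b x)‖ ^ 2 ≤ (pev p (-a x, b x)).im) ∧
      (pev p (a x, b x) = 0 ∨ pev p (-a x, b x) = 0 → x = 0) := by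
    intro p hp x hx
    obtain ⟨g0, g1, g2⟩ := hball (closedBall_subset_closedBall (hle.trans (min_le_right _ _)) hx)
    have i0 : min c0 (min c1 c2) ≤ c0 := min_le_left _ _
    have i1 : min c0 (min c1 c2) ≤ c1 := (min_le_right _ _).trans (min_le_left _ _)
    have i2 : min c0 (min c1 c2) ≤ c2 := (min_le_right _ _).trans (min_le_right _ _)
    rcases hp with rfl | rfl | rfl
    · exact ⟨le_trans (by gcongr) g0.1, le_trans (by gcongr) g0.2.1, g0.2.2⟩
    · exact ⟨le_trans (by gcongr) g1.1, le_trans (by gcongr) g1.2.1, g1.2.2⟩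
    · exact ⟨le_trans (by gcongr) g2.1, le_trans (by gcongr) g2.2.1, g2.2.2⟩
  refine ⟨hnρ, fun q hq => ?_⟩
  refine hq.mem_two_sheets hρ hT (fun x => by rw [hTF, ha]) hnρ
    (c := min c0 (min c1 c2)) (by positivity) _ (fun p hp x hx => (hcomb p hp x hx).1)
    (fun p hp x hx => (hcomb p hp x hx).2.1) (fun p hp x hx => (hcomb p hp x hx).2.2) ?_
  intro z hz
  have z0 := hz (kallinPoly ν 0 0) (by simp)
  have z1 := hz (kallinPoly ν 1 0) (by simp)
  have z2 := hz (kallinPoly ν 0 1) (by simp)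
  simp only [pev_kallinPoly, Complex.ofReal_zero, Complex.ofReal_one, zero_mul, one_mul,
    add_zero] at z0 z1 z2
  have zb : z.2 ^ 2 = 0 := by linear_combination z1 - z0
  have za : z.1 ^ 4 = 0 := by linear_combination z2 - z0
  exact Prod.ext (pow_eq_zero_iff (by norm_num) |>.1 za) (pow_eq_zero_iff (by norm_num) |>.1 zb)

end UmbrellaForm

end

namespace OrdLip

section

variable {E G H K : Type*} [NormedAddCommGroup E] [NormedAddCommGroup G] [NormedAddCommGroup H]
  [NormedAddCommGroup K] {j k : ℕ} {f g : E → G}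

lemma add (hf : OrdLip k f) (hg : OrdLip k g) : OrdLip k fun x => f x + g x := by
  obtain ⟨f0, C, hC, hf⟩ := hf
  obtain ⟨g0, D, hD, hg⟩ := hg
  refine ⟨by simp [f0, g0], C + D, by positivity, fun x y hx hy => ?_⟩
  have e : f x + g x - (f y + g y) = (f x - f y) + (g x - g y) := by abel
  rw [e]
  refine (norm_add_le _ _).trans ?_
  linarith [hf x y hx hy, hg x y hx hy]

lemma mono (hf : OrdLip k f) (h : j ≤ k) : OrdLip j f := by
  obtain ⟨f0, C, hC, hf⟩ := hf
  refine ⟨f0, C, hC, fun x y hx hy => (hf x y hx hy).trans ?_⟩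
  have : max ‖x‖ ‖y‖ ^ k ≤ max ‖x‖ ‖y‖ ^ j :=
    pow_le_pow_of_le_one (le_max_of_le_left (norm_nonneg _)) (max_le hx hy) h
  gcongr

variable [NormedSpace ℝ G] [NormedSpace ℝ H] [NormedSpace ℝ K]

lemma clm (hf : OrdLip k f) (A : G →L[ℝ] H) : OrdLip k fun x => A (f x) := by
  obtain ⟨f0, C, hC, hf⟩ := hf
  refine ⟨by simp [f0], ‖A‖ * C, by positivity, fun x y hx hy => ?_⟩
  rw [← map_sub]
  refine (A.le_opNorm _).trans ?_
  calc _ ≤ ‖A‖ * (C * max ‖x‖ ‖y‖ ^ k * ‖x - y‖) := by gcongr; exact hf x y hx hy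
    _ = _ := by ring

lemma bilin {g : E → H} (hf : OrdLip j f) (hg : OrdLip k g) (B : G →L[ℝ] H →L[ℝ] K) :
    OrdLip (j + k + 1) fun x => B (f x) (g x) := by
  obtain ⟨C', hC', hf'⟩ := hf.norm_le
  obtain ⟨D', hD', hg'⟩ := hg.norm_le
  obtain ⟨f0, C, hC, hf⟩ := hf
  obtain ⟨g0, D, hD, hg⟩ := hg
  refine ⟨by simp [f0], ‖B‖ * C' * D + ‖B‖ * C * D', by positivity, fun x y hx hy => ?_⟩
  have e : B (f x) (g x) - B (f y) (g y) = B (f x) (g x - g y) + B (f x - f y) (g y) := by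
    simp
  rw [e]
  set M := max ‖x‖ ‖y‖
  have hM : 0 ≤ M := le_max_of_le_left (norm_nonneg _)
  have h1 : ‖f x‖ ≤ C' * M ^ (j + 1) :=
    (hf' x hx).trans (by gcongr; exact le_max_left _ _)
  have h2 : ‖g y‖ ≤ D' * M ^ (k + 1) :=
    (hg' y hy).trans (by gcongr; exact le_max_right _ _)
  calc _ ≤ ‖B‖ * ‖f x‖ * ‖g x - g y‖ + ‖B‖ * ‖f x - f y‖ * ‖g y‖ :=
        (norm_add_le _ _).trans (add_le_add (B.le_opNorm₂ _ _) (B.le_opNorm₂ _ _))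
    _ ≤ ‖B‖ * (C' * M ^ (j + 1)) * (D * M ^ k * ‖x - y‖) +
        ‖B‖ * (C * M ^ j * ‖x - y‖) * (D' * M ^ (k + 1)) := by
        gcongr
        · exact hg x y hx hy
        · exact hf x y hx hy
    _ = _ := by ring

end

variable {E : Type*} [NormedAddCommGroup E] {j k : ℕ} {f g : E → ℂ}

lemma mul (hf : OrdLip j f) (hg : OrdLip k g) : OrdLip (j + k + 1) fun x => f x * g x :=
  hf.bilin hg (ContinuousLinearMap.mul ℝ ℂ)

lemma const_mul (hf : OrdLip k f) (c : ℂ) : OrdLip k fun x => c * f x :=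
  hf.clm (ContinuousLinearMap.mul ℝ ℂ c)

lemma of_clm {E G : Type*} [NormedAddCommGroup E] [NormedAddCommGroup G] [NormedSpace ℝ E]
    [NormedSpace ℝ G] (A : E →L[ℝ] G) : OrdLip 0 A :=
  ⟨map_zero A, ‖A‖, norm_nonneg _, fun x y _ _ => by
    rw [pow_zero, mul_one, ← map_sub]
    exact A.le_opNorm _⟩

lemma ofReal_fst : OrdLip 0 fun x : ℝ × ℝ => (x.1 : ℂ) :=
  of_clm (Complex.ofRealCLM.comp (ContinuousLinearMap.fst ℝ ℝ ℝ))

lemma ofReal_snd : OrdLip 0 fun x : ℝ × ℝ => (x.2 : ℂ) :=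
  of_clm (Complex.ofRealCLM.comp (ContinuousLinearMap.snd ℝ ℝ ℝ))

end OrdLip

section

variable {V : Type*} [NormedAddCommGroup V] [NormedSpace ℝ V] [ProperSpace V]
  {W : Type*} [NormedAddCommGroup W] [NormedSpace ℝ W]

/-- The remainder of the second order Taylor expansion at the origin has a Lipschitz constant of
second order. -/
lemma ContDiff.exists_taylor_remainder_lipschitz {φ : V → W} (hφ : ContDiff ℝ (⊤ : ℕ∞) φ) (R : ℝ) :
    ∃ C : ℝ, 0 ≤ C ∧ ∀ X Z : V, ‖X‖ ≤ R → ‖Z‖ ≤ R →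
      ‖(φ X - φ 0 - fderiv ℝ φ 0 X - (1 / 2 : ℝ) • fderiv ℝ (fderiv ℝ φ) 0 X X) -
        (φ Z - φ 0 - fderiv ℝ φ 0 Z - (1 / 2 : ℝ) • fderiv ℝ (fderiv ℝ φ) 0 Z Z)‖ ≤
      C * max ‖X‖ ‖Z‖ ^ 2 * ‖X - Z‖ := by
  have hψ : ContDiff ℝ (⊤ : ℕ∞) (fderiv ℝ φ) := hφ.fderiv_right (by simp)
  have hψ' : ContDiff ℝ 1 (fderiv ℝ (fderiv ℝ φ)) :=
    hψ.fderiv_right (WithTop.coe_le_coe.2 (le_top : (1 + 1 : ℕ∞) ≤ ⊤))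
  set ψ := fderiv ℝ φ with hψ_def
  set B := fderiv ℝ ψ 0 with hB
  have hsymm : ∀ u v, B u v = B v u := fun u v =>
    (hφ.contDiffAt (x := 0)).isSymmSndFDerivAt
      (by simpa using WithTop.coe_le_coe.2 (le_top : (2 : ℕ∞) ≤ ⊤)) u v
  obtain ⟨C, hC⟩ := hψ'.contDiffOn.exists_lipschitzOnWith one_ne_zero
    (convex_closedBall (0 : V) R) (isCompact_closedBall 0 R)
  have hdψ : ∀ X, HasFDerivAt ψ (fderiv ℝ ψ X) X := fun X =>
    ((hψ.differentiable (by simp)) X).hasFDerivAt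
  have hdφ : ∀ X, HasFDerivAt φ (ψ X) X := fun X => ((hφ.differentiable (by simp)) X).hasFDerivAt
  have h1 : ∀ X : V, ‖X‖ ≤ R → ‖ψ X - ψ 0 - B X‖ ≤ C * ‖X‖ ^ 2 := by
    intro X hX
    have hd : ∀ Z, HasFDerivAt (fun Z => ψ Z - ψ 0 - B Z) (fderiv ℝ ψ Z - B) Z := fun Z =>
      ((hdψ Z).sub_const _).sub B.hasFDerivAt
    have := (convex_closedBall (0 : V) ‖X‖).norm_image_sub_le_of_norm_hasFDerivWithin_le
      (f := fun Z => ψ Z - ψ 0 - B Z) (f' := fun Z => fderiv ℝ ψ Z - B) (C := C * ‖X‖)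
      (fun Z _ => (hd Z).hasFDerivWithinAt) (fun Z hZ => by
        rw [mem_closedBall_zero_iff] at hZ
        have h0 : (0 : V) ∈ closedBall (0 : V) R := by
          simpa using (norm_nonneg X).trans hX
        have := hC.norm_sub_le (x := Z) (y := 0) (by simpa using hZ.trans hX) h0
        rw [sub_zero] at this
        exact this.trans (by gcongr)) (x := 0) (y := X) (by simp) (by simp)
    simpa [sq, mul_assoc] using this
  refine ⟨C, C.2, fun X Z hX hZ => ?_⟩
  set M := max ‖X‖ ‖Z‖
  have hd : ∀ Z, HasFDerivAt
      (fun X => φ X - φ 0 - ψ 0 X - (1 / 2 : ℝ) • B X X) (ψ Z - ψ 0 - B Z) Z := by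
    intro Z
    have hq : HasFDerivAt (fun X => B X X) (B.precompR V Z (ContinuousLinearMap.id ℝ V) +
        B.precompL V (ContinuousLinearMap.id ℝ V) Z) Z :=
      B.hasFDerivAt_of_bilinear (hasFDerivAt_id Z) (hasFDerivAt_id Z)
    refine ((((hdφ Z).sub_const (φ 0)).sub (ψ 0).hasFDerivAt).sub
      (hq.const_smul (1 / 2 : ℝ))).congr_fderiv ?_
    ext v
    have : (1 / 2 : ℝ) • (B Z v + B v Z) = B Z v := by
      rw [hsymm v Z, ← two_smul ℝ (B Z v), smul_smul]
      norm_num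
    change ψ Z v - ψ 0 v - (1 / 2 : ℝ) • (B Z v + B v Z) = _
    rw [this]
    rfl
  exact (convex_closedBall (0 : V) M).norm_image_sub_le_of_norm_hasFDerivWithin_le
    (fun Y _ => (hd Y).hasFDerivWithinAt) (fun Y hY => by
      rw [mem_closedBall_zero_iff] at hY
      exact (h1 Y (hY.trans (max_le hX hZ))).trans (by gcongr))
    (by simp [M]) (by simp [M])

end

section

open Asymptotics Filter Topology

lemma whitneyPi_eq (x : ℝ × ℝ) : whitneyPi x = (x.1 * x.2) • ((1, 0) : ℂ × ℂ) +
    x.1 ^ 2 • (Complex.I, 0) + (2 / 3 * x.1 ^ 3) • (0, 1) + x.2 • (0, Complex.I) := by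
  rw [whitneyPi, mul_div_right_comm]
  ext1 <;> apply Complex.ext <;> simp [pow_succ]

lemma ordLip_whitneyPi_sub :
    OrdLip 1 fun x => whitneyPi x - x.2 • ((0, Complex.I) : ℂ × ℂ) := by
  have h1 : OrdLip 0 fun x : ℝ × ℝ => x.1 := OrdLip.of_clm (ContinuousLinearMap.fst ℝ ℝ ℝ)
  have h2 : OrdLip 0 fun x : ℝ × ℝ => x.2 := OrdLip.of_clm (ContinuousLinearMap.snd ℝ ℝ ℝ)
  have h12 := h1.bilin h2 (ContinuousLinearMap.mul ℝ ℝ)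
  have h11 := h1.bilin h1 (ContinuousLinearMap.mul ℝ ℝ)
  have h111 := (h1.bilin h11 (ContinuousLinearMap.mul ℝ ℝ)).mono (j := 1) (by norm_num)
  have := ((h12.clm ((ContinuousLinearMap.id ℝ ℝ).smulRight ((1, 0) : ℂ × ℂ))).add
    (h11.clm ((ContinuousLinearMap.id ℝ ℝ).smulRight ((Complex.I, 0) : ℂ × ℂ)))).add
    (h111.clm ((2 / 3 : ℝ) • (ContinuousLinearMap.id ℝ ℝ).smulRight ((0, 1) : ℂ × ℂ)))
  convert this using 2 with x
  rw [whitneyPi_eq]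
  simp only [add_sub_cancel_right]
  simp [pow_succ, mul_assoc]

lemma ordLip_whitneyPi : OrdLip 0 whitneyPi := by
  have h2 : OrdLip 0 fun x : ℝ × ℝ => x.2 • ((0, Complex.I) : ℂ × ℂ) :=
    OrdLip.of_clm ((ContinuousLinearMap.snd ℝ ℝ ℝ).smulRight ((0, Complex.I) : ℂ × ℂ))
  convert (ordLip_whitneyPi_sub.mono zero_le_one).add h2 using 2 with x
  simp

lemma continuous_whitneyPi : Continuous whitneyPi := by
  simp only [funext whitneyPi_eq]
  fun_prop

lemma whitneyPi_zero : whitneyPi 0 = 0 := by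
  rw [whitneyPi_eq]
  simp

lemma tsq_isBigO : (fun x : ℝ × ℝ => x.1 * x.2) =O[nhds 0] fun x => ‖x‖ * wt x :=
  fst_isBigO.mul snd_isBigO_wt

lemma tcube_isBigO : (fun x : ℝ × ℝ => x.1 ^ 3) =O[nhds 0] fun x => ‖x‖ * wt x :=
  (fst_isBigO.mul fst_sq_isBigO_wt).congr_left fun x => by ring

lemma whitneyPi_isBigO_wt : whitneyPi =O[nhds 0] wt := by
  have h1 := tsq_isBigO.trans SheetExpansion.norm_mul_wt
  have h3 := tcube_isBigO.trans SheetExpansion.norm_mul_wt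
  have hc : ∀ v : ℂ × ℂ, (fun _ : ℝ × ℝ => v) =O[nhds 0] fun _ => (1 : ℝ) :=
    fun v => isBigO_const_const v one_ne_zero _
  have := (((h1.smul (hc (1, 0))).add (fst_sq_isBigO_wt.smul (hc (Complex.I, 0)))).add
    ((h3.const_mul_left (2 / 3)).smul (hc (0, 1)))).add (snd_isBigO_wt.smul (hc (0, Complex.I)))
  simp only [smul_eq_mul, mul_one] at this
  exact this.congr_left fun x => (whitneyPi_eq x).symm

variable {φ : ℂ × ℂ → ℂ × ℂ}

lemma ContDiff.exists_ordLip_comp_whitneyPi (hφ : ContDiff ℝ (⊤ : ℕ∞) φ) :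
    ∃ q, OrdLip 2 fun x : ℝ × ℝ =>
      φ (whitneyPi x) - φ 0 - fderiv ℝ φ 0 (whitneyPi x) - (x.2 ^ 2) • q := by
  obtain ⟨C, hC, hC'⟩ := ordLip_whitneyPi.norm_le
  obtain ⟨D, hD, hr⟩ := hφ.exists_taylor_remainder_lipschitz C
  set L := fderiv ℝ φ 0
  set B := fderiv ℝ (fderiv ℝ φ) 0
  set e : ℂ × ℂ := (0, Complex.I)
  have h2 : OrdLip 0 fun x : ℝ × ℝ => x.2 • e :=
    OrdLip.of_clm ((ContinuousLinearMap.snd ℝ ℝ ℝ).smulRight e)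
  have hR : OrdLip 2 fun x : ℝ × ℝ => φ (whitneyPi x) - φ 0 - L (whitneyPi x) -
      (1 / 2 : ℝ) • B (whitneyPi x) (whitneyPi x) := by
    obtain ⟨-, E, hE, hπ⟩ := ordLip_whitneyPi
    refine ⟨by simp [whitneyPi_zero], D * C ^ 2 * E, by positivity, fun x y hx hy => ?_⟩
    have hb : ∀ z : ℝ × ℝ, ‖z‖ ≤ 1 → ‖whitneyPi z‖ ≤ C * ‖z‖ := fun z hz => by
      simpa using hC' z hz
    have hb1 : ∀ z : ℝ × ℝ, ‖z‖ ≤ 1 → ‖whitneyPi z‖ ≤ C := fun z hz =>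
      (hb z hz).trans (mul_le_of_le_one_right hC hz)
    have h3 := hπ x y hx hy
    rw [pow_zero, mul_one] at h3
    refine (hr _ _ (hb1 x hx) (hb1 y hy)).trans ?_
    have h4 : max ‖whitneyPi x‖ ‖whitneyPi y‖ ≤ C * max ‖x‖ ‖y‖ :=
      max_le ((hb x hx).trans (by gcongr; exact le_max_left _ _))
        ((hb y hy).trans (by gcongr; exact le_max_right _ _))
    calc _ ≤ D * (C * max ‖x‖ ‖y‖) ^ 2 * (E * ‖x - y‖) := by gcongr
      _ = _ := by ring
  refine ⟨(1 / 2 : ℝ) • B e e, ?_⟩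
  have hB := (ordLip_whitneyPi_sub.bilin ordLip_whitneyPi B).add
    (h2.bilin ordLip_whitneyPi_sub B)
  convert hR.add (hB.clm ((1 / 2 : ℝ) • ContinuousLinearMap.id ℝ (ℂ × ℂ))) using 2 with x
  simp only [map_sub, map_smul, sub_apply, smul_apply, ContinuousLinearMap.id_apply]
  simp only [smul_sub, smul_add, smul_smul]
  module

lemma ContDiff.comp_whitneyPi_sub_isBigO (hφ : ContDiff ℝ (⊤ : ℕ∞) φ) :
    (fun x => φ (whitneyPi x) - φ 0 - fderiv ℝ φ 0 (whitneyPi x)) =O[nhds 0]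
      fun x => wt x ^ 2 := by
  obtain ⟨D, hD, hr⟩ := hφ.exists_taylor_remainder_lipschitz 1
  set L := fderiv ℝ φ 0
  set B := fderiv ℝ (fderiv ℝ φ) 0
  have h : (fun X => φ X - φ 0 - L X) =O[nhds 0] fun X => ‖X‖ ^ 2 := by
    refine IsBigO.of_bound (D + 1 / 2 * ‖B‖) ?_
    filter_upwards [closedBall_mem_nhds (0 : ℂ × ℂ) one_pos] with X hX
    rw [mem_closedBall_zero_iff] at hX
    have h1 := hr X 0 hX (by simp)
    simp only [map_zero, smul_zero, sub_self, sub_zero, norm_zero,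
      max_eq_left (norm_nonneg X)] at h1
    have h2 : ‖(1 / 2 : ℝ) • B X X‖ ≤ 1 / 2 * (‖B‖ * ‖X‖ * ‖X‖) := by
      rw [norm_smul]
      have := B.le_opNorm₂ X X
      norm_num
      linarith
    have h3 := norm_sub_norm_le (φ X - φ 0 - L X) ((1 / 2 : ℝ) • B X X)
    have h4 : D * ‖X‖ ^ 2 * ‖X‖ ≤ D * ‖X‖ ^ 2 := mul_le_of_le_one_right (by positivity) hX
    rw [Real.norm_of_nonneg (by positivity)]
    linarith
  have ht : Tendsto whitneyPi (nhds 0) (nhds 0) := by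
    simpa [whitneyPi_zero] using continuous_whitneyPi.tendsto 0
  exact (h.comp_tendsto ht).trans (whitneyPi_isBigO_wt.norm_left.pow 2)

end

section

open Asymptotics Filter Topology

variable {φ : ℂ × ℂ → ℂ × ℂ}

lemma clm_whitneyPi (T : ℂ × ℂ →L[ℝ] ℂ) (x : ℝ × ℝ) : T (whitneyPi x) =
    (x.1 * x.2 : ℝ) * T (1, 0) + (x.1 ^ 2 : ℝ) * T (Complex.I, 0) +
    (2 / 3 * x.1 ^ 3 : ℝ) * T (0, 1) + x.2 * T (0, Complex.I) := by
  rw [whitneyPi_eq]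
  simp only [map_add, map_smul, Complex.real_smul]

lemma exists_umbrellaForm (hφ : ContDiff ℝ (⊤ : ℕ∞) φ) {L : ℂ × ℂ →L[ℝ] ℂ × ℂ}
    (hL : fderiv ℝ φ 0 = L) (Z W : ℂ × ℂ →L[ℝ] ℂ) {k : ℂ} {m : ℝ} (hm : 0 < m)
    (hk : k.im = -(m / 2)) (hZx : Z (L (1, 0)) = 2 * k) (hZy : Z (L (Complex.I, 0)) = 1)
    (hZv : Z (L (0, Complex.I)) = 0) (hWx : (W (L (1, 0))).im = 0)
    (hWy : (W (L (Complex.I, 0))).im = 0) (hWu : (W (L (0, 1))).im < 0)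
    (hWv : W (L (0, Complex.I)) = 1) :
    ∃ c α β κ, UmbrellaForm
      (fun x => Z (φ (whitneyPi x) - φ 0) + c * W (φ (whitneyPi x) - φ 0) ^ 2)
      (fun x => W (φ (whitneyPi x) - φ 0)) k α β κ m := by
  obtain ⟨q, hq⟩ := hφ.exists_ordLip_comp_whitneyPi
  have hO := hφ.comp_whitneyPi_sub_isBigO
  rw [hL] at hq hO
  obtain ⟨G, hG⟩ : ∃ G : ℝ × ℝ → ℂ × ℂ, ∀ x, φ (whitneyPi x) - φ 0 = G x := ⟨_, fun _ => rfl⟩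
  simp only [hG] at hq hO ⊢
  have ZL : ∀ x, Z (L (whitneyPi x)) = (x.1 * x.2 : ℝ) * (2 * k) + (x.1 ^ 2 : ℝ) +
      (2 / 3 * x.1 ^ 3 : ℝ) * Z (L (0, 1)) := fun x => by
    have := clm_whitneyPi (Z.comp L) x
    simp only [ContinuousLinearMap.comp_apply, hZx, hZy, hZv] at this
    rw [this]
    ring
  have WL : ∀ x, W (L (whitneyPi x)) = (x.1 * x.2 : ℝ) * W (L (1, 0)) +
      (x.1 ^ 2 : ℝ) * W (L (Complex.I, 0)) + (2 / 3 * x.1 ^ 3 : ℝ) * W (L (0, 1)) + x.2 :=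
    fun x => by
    have := clm_whitneyPi (W.comp L) x
    simp only [ContinuousLinearMap.comp_apply, hWv] at this
    rw [this]
    ring
  have ht := OrdLip.ofReal_fst
  have hs := OrdLip.ofReal_snd
  have hlin : OrdLip 1 fun x => W (G x) - x.2 := by
    have := ((((ht.mul hs).const_mul (W (L (1, 0)))).add
      ((ht.mul ht).const_mul (W (L (Complex.I, 0))))).add
      (((ht.mul (ht.mul ht)).const_mul (2 / 3 * W (L (0, 1)))).mono (by norm_num))).add
      (((hq.clm W).mono (by norm_num)).add ((hs.mul hs).const_mul (W q)))
    convert this using 2 with x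
    simp only [map_sub, map_smul, WL, Complex.real_smul]
    push_cast
    ring
  have hcubic : ∀ T : ℂ × ℂ →L[ℝ] ℂ,
      (fun t : ℝ => T (G (t, 0) - L (whitneyPi (t, 0)))) =O[nhds 0] fun t : ℝ => t ^ 4 := by
    intro T
    have h0 : Tendsto (fun t : ℝ => ((t, 0) : ℝ × ℝ)) (nhds 0) (nhds 0) :=
      (by fun_prop : Continuous fun t : ℝ => ((t, 0) : ℝ × ℝ)).tendsto 0
    refine (((T.isBigO_comp _ _).trans hO).comp_tendsto h0).congr_right fun t => ?_
    simp [wt]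
    ring
  have hwt : (fun x => wt x ^ 2) =O[nhds 0] fun x => ‖x‖ * wt x := by
    simpa [sq] using wt_isBigO_norm.mul (isBigO_refl wt (nhds 0))
  have hWO : (fun x => W (G x - L (whitneyPi x))) =O[nhds 0] fun x => wt x ^ 2 :=
    (W.isBigO_comp _ _).trans hO
  refine ⟨k ^ 2 - Z q, Z (L (0, 1)) / 3, (W (L (Complex.I, 0))).re, -(2 / 3 * (W (L (0, 1))).im),
    hm, by linarith, hk, ?_, ?_, hlin, ?_, ?_⟩
  · have h3 := ((ht.mul (ht.mul ht)).const_mul (2 / 3 * Z (L (0, 1))))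
    have := ((hq.clm Z).add h3).add ((((hs.mul hlin).const_mul 2).add
      ((hlin.mul hlin).mono (by norm_num))).const_mul (k ^ 2 - Z q))
    convert this using 2 with x
    simp only [map_sub, map_smul, ZL, Complex.real_smul]
    push_cast
    ring
  · have hb : (fun t : ℝ => W (G (t, 0))) =O[nhds 0] fun t : ℝ => t ^ 2 := by
      have h3 : (fun t : ℝ => ((t ^ 3 : ℝ) : ℂ)) =O[nhds 0] fun t : ℝ => t ^ 2 :=
        Complex.isBigO_ofReal_left.2 (isLittleO_pow_pow (by norm_num)).isBigO
      have h2 : (fun t : ℝ => ((t ^ 2 : ℝ) : ℂ)) =O[nhds 0] fun t : ℝ => t ^ 2 :=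
        Complex.isBigO_ofReal_left.2 (isBigO_refl _ _)
      refine (((hcubic W).trans (isLittleO_pow_pow (by norm_num)).isBigO).add
        ((h2.const_mul_left (W (L (Complex.I, 0)))).add
        (h3.const_mul_left (2 / 3 * W (L (0, 1)))))).congr_left fun t => ?_
      simp only [map_sub, WL]
      push_cast
      ring
    have h2 := ((hb.pow 2).const_mul_left (k ^ 2 - Z q))
    refine ((hcubic Z).add (h2.congr_right fun t => by ring)).congr_left fun t => ?_
    simp only [map_sub, ZL]
    push_cast
    ring
  · have hre : (fun x => (W (G x - L (whitneyPi x))).re) =O[nhds 0] fun x => ‖x‖ * wt x :=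
      (isBigO_of_le _ fun x => Complex.abs_re_le_norm _).trans (hWO.trans hwt)
    refine (hre.add ((tsq_isBigO.const_mul_left (W (L (1, 0))).re).add
      (tcube_isBigO.const_mul_left (2 / 3 * (W (L (0, 1))).re)))).congr_left fun x => ?_
    simp only [map_sub, WL, Complex.sub_re, Complex.add_re, Complex.re_ofReal_mul,
      Complex.ofReal_re]
    ring
  · have him : (fun x => (W (G x - L (whitneyPi x))).im) =O[nhds 0] fun x => wt x ^ 2 :=
      (isBigO_of_le _ fun x => Complex.abs_im_le_norm _).trans hWO
    refine him.congr_left fun x => ?_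
    simp only [map_sub, WL, Complex.sub_im, Complex.add_im, Complex.im_ofReal_mul,
      Complex.ofReal_im, hWx, hWy]
    ring

end

/-- The complex linear form with coefficients `a` and `b`, as a real linear map. -/
def linForm (a b : ℂ) : ℂ × ℂ →L[ℝ] ℂ :=
  (a • ContinuousLinearMap.fst ℂ ℂ ℂ + b • ContinuousLinearMap.snd ℂ ℂ ℂ).restrictScalars ℝ

@[simp] lemma linForm_apply (a b : ℂ) (v : ℂ × ℂ) : linForm a b v = a * v.1 + b * v.2 := rfl

lemma omegaSt_eq_im (f v : ℂ × ℂ) :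
    omegaSt f v = (star f.1 * v.1 + star f.2 * v.2).im := by
  simp [omegaSt]
  ring

lemma normSq_mul_omegaSt (f u v : ℂ × ℂ) :
    (Complex.normSq f.1 + Complex.normSq f.2) * omegaSt u v =
      (star (f.2 * u.1 - f.1 * u.2) * (f.2 * v.1 - f.1 * v.2)).im +
      (star (star f.1 * u.1 + star f.2 * u.2) * (star f.1 * v.1 + star f.2 * v.2)).im := by
  simp [omegaSt, Complex.normSq_apply]
  ring

lemma exists_adapted_linForm {L : ℂ × ℂ →L[ℝ] ℂ × ℂ}
    (hL : ∀ u v, omegaSt (L u) (L v) = omegaSt u v) :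
    ∃ a b c d k : ℂ, ∃ m : ℝ, a * d - b * c ≠ 0 ∧ 0 < m ∧ k.im = -(m / 2) ∧
      linForm a b (L (1, 0)) = 2 * k ∧ linForm a b (L (Complex.I, 0)) = 1 ∧
      linForm a b (L (0, Complex.I)) = 0 ∧ (linForm c d (L (1, 0))).im = 0 ∧
      (linForm c d (L (Complex.I, 0))).im = 0 ∧ (linForm c d (L (0, 1))).im < 0 ∧
      linForm c d (L (0, Complex.I)) = 1 := by
  have hu := hL (0, Complex.I) (0, 1)
  have hx := hL (0, Complex.I) (1, 0)
  have hy := hL (0, Complex.I) (Complex.I, 0)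
  have hxy := hL (1, 0) (Complex.I, 0)
  have key := normSq_mul_omegaSt (L (0, Complex.I)) (L (1, 0)) (L (Complex.I, 0))
  set f := L (0, Complex.I)
  set X := L (1, 0)
  set Y := L (Complex.I, 0)
  set U := L (0, 1)
  rw [hxy] at key
  rw [omegaSt_eq_im] at hu hx hy
  have e1 : omegaSt (1, 0) (Complex.I, 0) = 1 := by simp [omegaSt]
  have e2 : omegaSt (0, Complex.I) (0, 1) = -1 := by simp [omegaSt]
  have e3 : omegaSt (0, Complex.I) (1, 0) = 0 := by simp [omegaSt]
  have e4 : omegaSt (0, Complex.I) (Complex.I, 0) = 0 := by simp [omegaSt]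
  rw [e1, mul_one] at key
  rw [e2] at hu
  rw [e3] at hx
  rw [e4] at hy
  set N := Complex.normSq f.1 + Complex.normSq f.2 with hN
  have hN0 : N ≠ 0 := by
    intro h0
    have h1 : f.1 = 0 := Complex.normSq_eq_zero.1
      (le_antisymm (by linarith [Complex.normSq_nonneg f.2]) (Complex.normSq_nonneg _))
    have h2 : f.2 = 0 := Complex.normSq_eq_zero.1
      (le_antisymm (by linarith [Complex.normSq_nonneg f.1]) (Complex.normSq_nonneg _))
    simp [h1, h2] at hu
  have hNpos : 0 < N := lt_of_le_of_ne
    (add_nonneg (Complex.normSq_nonneg _) (Complex.normSq_nonneg _)) hN0.symm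
  have hNc : (N : ℂ) = star f.1 * f.1 + star f.2 * f.2 := by
    rw [hN]
    push_cast
    rw [Complex.normSq_eq_conj_mul_self, Complex.normSq_eq_conj_mul_self]
    rfl
  have hNc0 : (N : ℂ) ≠ 0 := by exact_mod_cast hN0
  set ξ := f.2 * X.1 - f.1 * X.2 with hξ
  set η := f.2 * Y.1 - f.1 * Y.2 with hη
  have hreal : (star (star f.1 * X.1 + star f.2 * X.2) * (star f.1 * Y.1 + star f.2 * Y.2)).im =
      0 := by
    have him : ∀ z w : ℂ, (star z * w).im = z.re * w.im - z.im * w.re := fun z w => by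
      simp
      ring
    rw [him, hx, hy]
    ring
  rw [hreal, add_zero] at key
  have hη0 : η ≠ 0 := by
    intro h0
    rw [h0, mul_zero, Complex.zero_im] at key
    exact hN0 key
  have hdiv : ∀ v : ℂ × ℂ, linForm (star f.1 / N) (star f.2 / N) v =
      (star f.1 * v.1 + star f.2 * v.2) / N := fun v => by
    rw [linForm_apply]
    ring
  have hdiv' : ∀ v : ℂ × ℂ, linForm (f.2 / η) (-(f.1 / η)) v =
      (f.2 * v.1 - f.1 * v.2) / η := fun v => by
    rw [linForm_apply]
    ring
  refine ⟨f.2 / η, -(f.1 / η), star f.1 / N, star f.2 / N, ξ / η / 2, N / Complex.normSq η,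
    ?_, div_pos hNpos (Complex.normSq_pos.2 hη0), ?_, ?_, ?_, ?_, ?_, ?_, ?_, ?_⟩
  · have : f.2 / η * (star f.2 / N) - -(f.1 / η) * (star f.1 / N) = 1 / η := by
      field_simp
      rw [hNc]
      ring
    rw [this]
    exact one_div_ne_zero hη0
  · have h1 : (ξ / η / 2).im = (ξ / η).im / 2 := by
      rw [show (2 : ℂ) = ((2 : ℝ) : ℂ) by norm_num, Complex.div_ofReal_im]
    rw [h1, Complex.div_im, key]
    simp
    ring
  · rw [hdiv']
    ring
  · rw [hdiv', ← hη, div_self hη0]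
  · rw [hdiv']
    ring
  · rw [hdiv, Complex.div_ofReal_im, hx, zero_div]
  · rw [hdiv, Complex.div_ofReal_im, hy, zero_div]
  · rw [hdiv, Complex.div_ofReal_im, hu]
    exact div_neg_of_neg_of_pos (by norm_num) hNpos
  · rw [hdiv, ← hNc, div_self hNc0]

lemma exists_whitney_hull_subset {φ : ℂ × ℂ → ℂ × ℂ} (hφ : ContDiff ℝ (⊤ : ℕ∞) φ)
    (hL : ∀ u v, omegaSt (fderiv ℝ φ 0 u) (fderiv ℝ φ 0 v) = omegaSt u v) :
    ∃ A b : ℝ × ℝ → ℂ, ∃ ρ₀ > 0, ∀ ρ, 0 < ρ → ρ ≤ ρ₀ → NearId A b ρ ∧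
      ∀ q, InHull ((fun x => φ (whitneyPi x)) '' boxDomain A b ρ) q →
        q ∈ (fun x => φ (whitneyPi x)) '' boxDomain A b ρ := by
  obtain ⟨a, b, c, d, k, m, hdet, hm, hk, h1, h2, h3, h4, h5, h6, h7⟩ :=
    exists_adapted_linForm hL
  obtain ⟨e, α, β, κ, h⟩ := exists_umbrellaForm hφ rfl _ _ hm hk h1 h2 h3 h4 h5 h6 h7
  set p := φ 0
  let T2 : MvPolynomial (Fin 2) ℂ :=
    MvPolynomial.C c * (MvPolynomial.X 0 - MvPolynomial.C p.1) +
      MvPolynomial.C d * (MvPolynomial.X 1 - MvPolynomial.C p.2)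
  let T1 : MvPolynomial (Fin 2) ℂ :=
    MvPolynomial.C a * (MvPolynomial.X 0 - MvPolynomial.C p.1) +
      MvPolynomial.C b * (MvPolynomial.X 1 - MvPolynomial.C p.2) + MvPolynomial.C e * T2 ^ 2
  have e2 : ∀ x, pev T2 x = linForm c d (x - p) := fun x => by simp [T2]
  have e1 : ∀ x, pev T1 x = linForm a b (x - p) + e * linForm c d (x - p) ^ 2 := fun x => by
    rw [← e2]
    simp [T1]
  have hinj : Function.Injective fun x => (pev T1 x, pev T2 x) := by
    intro x y hxy
    simp only [e1, e2, Prod.mk.injEq] at hxy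
    obtain ⟨ha, hc⟩ := hxy
    rw [hc, add_left_inj] at ha
    simp only [linForm_apply, Prod.fst_sub, Prod.snd_sub] at ha hc
    refine Prod.ext (mul_left_cancel₀ hdet ?_) (mul_left_cancel₀ hdet ?_)
    · linear_combination d * ha - b * hc
    · linear_combination a * hc - c * ha
  obtain ⟨A, hA⟩ := h.exists_hull_subset (F := fun x => φ (whitneyPi x)) hinj
    (fun x => by rw [e1, e2])
  exact ⟨A, _, hA⟩

lemma image_whitneyPi_mem_nhdsWithin {φ : ℂ × ℂ → ℂ × ℂ} (hφ : Function.Injective φ)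
    (hinv : Continuous (Function.invFun φ)) {D : Set (ℝ × ℝ)} (hD : D ∈ nhds 0) :
    (fun x => φ (whitneyPi x)) '' D ∈ nhdsWithin (φ 0) (φ '' Set.range whitneyPi) := by
  obtain ⟨δ, hδ, hball⟩ := Metric.mem_nhds_iff.1 hD
  have hcont : Continuous fun p : ℂ × ℂ => max √|p.1.im| |p.2.im| := by fun_prop
  have hU : ∀ᶠ p in nhds (φ 0),
      max √|(Function.invFun φ p).1.im| |(Function.invFun φ p).2.im| < δ := by
    refine (hcont.comp hinv).continuousAt.eventually_lt continuousAt_const ?_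
    simpa [Function.leftInverse_invFun hφ 0] using hδ
  filter_upwards [nhdsWithin_le_nhds hU, self_mem_nhdsWithin] with p hp hpr
  obtain ⟨_, ⟨x, rfl⟩, rfl⟩ := hpr
  rw [Function.leftInverse_invFun hφ] at hp
  refine ⟨x, hball ?_, rfl⟩
  rw [mem_ball_zero_iff, Prod.norm_def]
  simpa [whitneyPi, Real.sqrt_sq_eq_abs] using hp

/-- Any smooth open Whitney umbrella `φ(Σ)` in `ℂ²`, where `φ` is a smooth
symplectomorphism of `ℂ²` and `Σ` is the standard open Whitney umbrella, is locally
polynomially convex at `φ(0)`: every closed ball around `φ(0)` contains a compact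
polynomially convex subset of `φ(Σ)` which is a relative neighbourhood of `φ(0)` in `φ(Σ)`. -/
theorem open_whitney_umbrella_locally_polynomially_convex
    (φ : ℂ × ℂ → ℂ × ℂ)
    (hφ_smooth : ContDiff ℝ (⊤ : ℕ∞) φ)
    (hφ_bij : Function.Bijective φ)
    (hφ_inv_smooth : ContDiff ℝ (⊤ : ℕ∞) (Function.invFun φ))
    (hφ_symp : ∀ p u v : ℂ × ℂ,
      omegaSt (fderiv ℝ φ p u) (fderiv ℝ φ p v) = omegaSt u v) :
    ∀ ε > 0, ∃ K : Set (ℂ × ℂ),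
      IsCompact K ∧ IsPolynomiallyConvex K ∧ φ 0 ∈ K ∧
      K ⊆ (φ '' Set.range whitneyPi) ∩ closedBall (φ 0) ε ∧
      K ∈ nhdsWithin (φ 0) (φ '' Set.range whitneyPi) := by
  intro ε hε
  obtain ⟨A, b, ρ₀, hρ₀, hA⟩ := exists_whitney_hull_subset hφ_smooth (hφ_symp 0)
  have hF : Continuous fun x => φ (whitneyPi x) := hφ_smooth.continuous.comp continuous_whitneyPi
  have hball : (fun x => φ (whitneyPi x)) ⁻¹' closedBall (φ 0) ε ∈ nhds 0 := by
    refine hF.continuousAt.preimage_mem_nhds ?_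
    rw [whitneyPi_zero]
    exact closedBall_mem_nhds _ hε
  obtain ⟨r, hr, hrball⟩ := Metric.nhds_basis_closedBall.mem_iff.1 hball
  have hρ : 0 < min r ρ₀ := lt_min hr hρ₀
  obtain ⟨hN, hH⟩ := hA _ hρ (min_le_right _ _)
  have hK := hN.isCompact_boxDomain.image hF
  have h0 : φ 0 ∈ (fun x => φ (whitneyPi x)) '' boxDomain A b (min r ρ₀) :=
    ⟨0, hN.zero_mem hρ, by simp [whitneyPi_zero]⟩
  refine ⟨_, hK, ?_, h0, ?_,
    image_whitneyPi_mem_nhdsWithin hφ_bij.injective hφ_inv_smooth.continuous (hN.mem_nhds hρ)⟩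
  · exact Set.Subset.antisymm (fun q hq => hH q (inHull_of_mem_polyHull2 ⟨_, h0⟩ hq))
      (subset_polyHull2 hK)
  · rintro _ ⟨x, hx, rfl⟩
    exact ⟨⟨_, ⟨x, rfl⟩, rfl⟩,
      hrball (closedBall_subset_closedBall (min_le_left _ _) hx.1)⟩
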